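/- arXiv:2512.07751 — 7 statements merged into one kernel-verified Lean document; each statement's English description precedes it below -/
import Mathlib

section
/- Let G be a k-graph and let S be a supported set in G with |S| ≤ k−1. Then the number d(S) of edges of G containing S satisfies d(S) ≥ δ*(G)^{k−|S|} / (k−|S|)!. -/
open Finset

/-- If every supported `(k-1)`-set lies in at least `d` edges, then a supported set `S` with
`|S| < k` has at least `d` vertices `v ∉ S` for which `insert v S` is supported. -/
lemma le_card_supported_insert {α : Type*} [Fintype α] [DecidableEq α] {k d : ℕ}
    {E : Finset (Finset α)} (hE : ∀ e ∈ E, e.card = k)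
    (hδ : ∀ T : Finset α, T.card = k - 1 → (∃ e ∈ E, T ⊆ e) →
      d ≤ (E.filter fun e => T ⊆ e).card)
    {S : Finset α} (hS : S.card < k) (hsupp : ∃ e ∈ E, S ⊆ e) :
    d ≤ (Sᶜ.filter fun v => ∃ e ∈ E, insert v S ⊆ e).card := by
  obtain ⟨e₀, he₀, hSe₀⟩ := hsupp
  obtain ⟨T, hST, hTe₀, hT⟩ := exists_subsuperset_card_eq hSe₀ (n := k - 1) (by omega)
    (by rw [hE e₀ he₀]; omega)
  refine (hδ T hT ⟨e₀, he₀, hTe₀⟩).trans ?_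
  conv_rhs => rw [← Nat.choose_one_right (card _), ← card_powersetCard]
  refine card_le_card_of_injOn (· \ T) ?_ ?_
  · intro e he
    obtain ⟨he, hTe⟩ := mem_filter.1 he
    refine mem_powersetCard.2 ⟨fun v hv => ?_, ?_⟩
    · obtain ⟨hve, hvT⟩ := mem_sdiff.1 hv
      exact mem_filter.2 ⟨mem_compl.2 fun h => hvT (hST h), e, he,
        insert_subset hve (hST.trans hTe)⟩
    · rw [card_sdiff_of_subset hTe, hE e he, hT]
      omega
  · intro e he f hf hef
    rw [← sdiff_union_of_subset (mem_filter.1 he).2, ← sdiff_union_of_subset (mem_filter.1 hf).2]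
    exact congrArg (· ∪ T) hef

/-- Double counting pairs `(e, v)` with `S ⊆ e` and `v ∈ e \ S`. -/
lemma sum_card_filter_insert_subset {α : Type*} [Fintype α] [DecidableEq α] {k : ℕ}
    {E : Finset (Finset α)} (hE : ∀ e ∈ E, e.card = k) (S : Finset α) :
    ∑ v ∈ Sᶜ, (E.filter fun e => insert v S ⊆ e).card =
      (k - S.card) * (E.filter fun e => S ⊆ e).card := by
  have h := sum_card_bipartiteAbove_eq_sum_card_bipartiteBelow (s := E.filter fun e => S ⊆ e)
    (t := Sᶜ) (fun e v => v ∈ e)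
  rw [mul_comm, ← smul_eq_mul, ← sum_const]
  refine Eq.trans (sum_congr rfl fun v _ => ?_) (h.symm.trans (sum_congr rfl fun e he => ?_))
  · congr 1
    ext e
    simp only [mem_filter, mem_bipartiteBelow, insert_subset_iff]
    tauto
  · obtain ⟨he, hSe⟩ := mem_filter.1 he
    rw [← hE e he, ← card_sdiff_of_subset hSe]
    congr 1
    ext v
    simp only [mem_bipartiteAbove, mem_compl, mem_sdiff]
    tauto

lemma pow_le_factorial_mul_card_filter_subset {α : Type*} [Fintype α] [DecidableEq α] {k d : ℕ}
    {E : Finset (Finset α)} (hE : ∀ e ∈ E, e.card = k)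
    (hδ : ∀ T : Finset α, T.card = k - 1 → (∃ e ∈ E, T ⊆ e) →
      d ≤ (E.filter fun e => T ⊆ e).card)
    (m : ℕ) {S : Finset α} (hS : S.card + m = k) (hsupp : ∃ e ∈ E, S ⊆ e) :
    d ^ m ≤ m.factorial * (E.filter fun e => S ⊆ e).card := by
  induction m generalizing S with
  | zero =>
    obtain ⟨e, he, hSe⟩ := hsupp
    simpa using card_pos.2 ⟨e, mem_filter.2 ⟨he, hSe⟩⟩
  | succ m ih =>
    have hcount := sum_card_filter_insert_subset hE S
    rw [show k - S.card = m + 1 by omega] at hcount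
    set N := Sᶜ.filter fun v => ∃ e ∈ E, insert v S ⊆ e with hN
    calc d ^ (m + 1) = d * d ^ m := pow_succ' d m
      _ ≤ N.card * d ^ m :=
        Nat.mul_le_mul_right _ (le_card_supported_insert hE hδ (by omega) hsupp)
      _ = ∑ _v ∈ N, d ^ m := by rw [sum_const, smul_eq_mul]
      _ ≤ ∑ v ∈ N, m.factorial * (E.filter fun e => insert v S ⊆ e).card := by
        refine sum_le_sum fun v hv => ?_
        obtain ⟨hvS, hv⟩ := mem_filter.1 hv
        refine ih ?_ hv
        rw [card_insert_of_notMem (mem_compl.1 hvS)]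
        omega
      _ ≤ ∑ v ∈ Sᶜ, m.factorial * (E.filter fun e => insert v S ⊆ e).card :=
        sum_le_sum_of_subset (filter_subset _ _)
      _ = (m + 1).factorial * (E.filter fun e => S ⊆ e).card := by
        rw [← mul_sum, hcount, Nat.factorial_succ]
        ring

/-- If every supported `(k-1)`-set of a `k`-graph is contained in at least `d`
edges (i.e. `d ≤ δ*(G)`), then every supported set `S` with `|S| ≤ k-1` is
contained in at least `d^(k-|S|) / (k-|S|)!` edges. -/
theorem supported_codegree_to_degree
    (k n : ℕ) (E : Finset (Finset (Fin n))) (hE : ∀ e ∈ E, e.card = k)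
    (d : ℕ)
    (hδ : ∀ S : Finset (Fin n), S.card = k - 1 → (∃ e ∈ E, S ⊆ e) →
      d ≤ (E.filter fun e => S ⊆ e).card)
    (S : Finset (Fin n)) (hS : S.card ≤ k - 1) (hsupp : ∃ e ∈ E, S ⊆ e) :
    ((d : ℝ) ^ (k - S.card)) / (Nat.factorial (k - S.card) : ℝ) ≤
      ((E.filter fun e => S ⊆ e).card : ℝ) := by
  obtain ⟨e, he, hSe⟩ := hsupp
  have hSk : S.card ≤ k := hE e he ▸ card_le_card hSe
  rw [div_le_iff₀' (by positivity)]
  exact_mod_cast pow_le_factorial_mul_card_filter_subset hE hδ (k - S.card) (by omega) ⟨e, he, hSe⟩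
end

section
/- Let k ≥ 3 and ℓ ∈ [k−1], and set t = ⌊k/(k−ℓ)⌋·(k−ℓ). There exists ε₀ > 0 (depending on k) such that for every ε ∈ (0, ε₀] there exists n₀ such that the following holds for every n ≥ n₀ divisible by t. Let w* = (w_1,…,w_k) with w_1 = k−1 and w_i = t−1 for 2 ≤ i ≤ k. If H is an n-vertex k-graph with no isolated vertices and δ*(H) ≥ (1 − 1/t − ε)·n, such that every set of at least n/t vertices contains at least 4εn² supported pairs, then H has a w*-weighted perfect fractional matching. -/
open Finset

/-- The ordered edges of the `k`-graph with edge set `E`: injective `k`-tuples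
of vertices whose image is an edge. -/
def orderedEdges (k : ℕ) {n : ℕ} (E : Finset (Finset (Fin n))) :
    Finset (Fin k → Fin n) :=
  Finset.univ.filter fun e => Function.Injective e ∧ Finset.image e Finset.univ ∈ E

/-- Farkas' lemma for the all-ones vector and finitely many vectors of equal positive
coordinate sum. -/
theorem exists_nonneg_combination_eq_one {α V : Type*} [Fintype α] [Fintype V] [Nonempty V]
    (a : α → V → ℝ) (W : ℝ) (hW : 0 < W) (ha : ∀ e, ∑ v, a e v = W)
    (h : ∀ y : V → ℝ, (∀ e, 0 < ∑ v, a e v * y v) → 0 ≤ ∑ v, y v) :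
    ∃ q : α → ℝ, (∀ e, 0 ≤ q e) ∧ ∀ v, ∑ e, q e * a e v = 1 := by
  classical
  have hn : (0 : ℝ) < Fintype.card V := by exact_mod_cast Fintype.card_pos
  let L : (α → ℝ) →ₗ[ℝ] (V → ℝ) := Fintype.linearCombination ℝ a
  have hL (q : α → ℝ) (v : V) : L q v = ∑ e, q e * a e v := by
    simp [L, Fintype.linearCombination_apply]
  let b : V → ℝ := fun _ => W / Fintype.card V
  by_cases hb : b ∈ L '' stdSimplex ℝ α
  · obtain ⟨q, ⟨hq, -⟩, hqb⟩ := hb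
    refine ⟨fun e => Fintype.card V / W * q e, fun e => mul_nonneg (by positivity) (hq e),
      fun v => ?_⟩
    have := congrFun hqb v
    rw [hL] at this
    simp only [mul_assoc, ← mul_sum, this, b]
    field_simp
  · exfalso
    have hcomp : IsCompact (L '' stdSimplex ℝ α) :=
      (isCompact_stdSimplex ℝ α).image L.continuous_of_finiteDimensional
    obtain ⟨f, u, hfb, hfu⟩ := geometric_hahn_banach_point_closed
      ((convex_stdSimplex ℝ α).linear_image L) hcomp.isClosed hb
    let g : V → ℝ := fun v => f (Pi.single v 1)
    have hf (x : V → ℝ) : f x = ∑ v, x v * g v := by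
      conv_lhs => rw [pi_eq_sum_univ' x]
      simp only [map_sum, map_smul, smul_eq_mul, g]
    have hpos (e : α) : 0 < ∑ v, a e v * (g v - u / W) := by
      have h1 := hfu (L (Pi.single e 1)) ⟨_, single_mem_stdSimplex ℝ e, rfl⟩
      have h2 : L (Pi.single e 1) = a e := by simp [L]
      rw [h2, hf] at h1
      simp only [mul_sub, sum_sub_distrib, ← sum_mul, ha]
      field_simp
      linarith
    have h3 := h _ hpos
    rw [hf] at hfb
    simp only [b, ← mul_sum] at hfb
    simp only [sum_sub_distrib, sum_const, card_univ, nsmul_eq_mul] at h3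
    have h4 : W / Fintype.card V * (Fintype.card V * (u / W)) = u := by field_simp
    have h5 : 0 < W / (Fintype.card V : ℝ) := by positivity
    nlinarith

/-- There is a set of any prescribed size on which `y` takes its smallest values. -/
theorem exists_lower_subset {V : Type*} [Fintype V] [DecidableEq V] (y : V → ℝ) (p : ℕ)
    (hp : p ≤ Fintype.card V) :
    ∃ P : Finset V, #P = p ∧ ∀ a ∈ P, ∀ b ∉ P, y a ≤ y b := by
  induction p with
  | zero => exact ⟨∅, by simp⟩
  | succ p ih =>
    obtain ⟨P, hP, hy⟩ := ih (by omega)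
    have hne : (Pᶜ).Nonempty := by
      rw [← card_pos, card_compl]
      omega
    obtain ⟨x, hx, hmin⟩ := exists_min_image Pᶜ y hne
    rw [mem_compl] at hx
    refine ⟨insert x P, by rw [card_insert_of_notMem hx, hP], fun a ha b hb => ?_⟩
    rw [mem_insert, not_or] at hb
    rcases mem_insert.1 ha with rfl | ha
    · exact hmin b (mem_compl.2 hb.2)
    · exact hy a ha b hb.2

/-- A supported set extends to an edge inside any vertex set that meets the neighbourhood of
every supported `(k-1)`-set. -/
theorem exists_edge_sdiff_subset {V : Type*} [Fintype V] [DecidableEq V] {k d : ℕ}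
    {E : Finset (Finset V)} (hE : ∀ e ∈ E, #e = k)
    (hd : ∀ S : Finset V, #S = k - 1 → (∃ e ∈ E, S ⊆ e) → d ≤ #{e ∈ E | S ⊆ e})
    (P : Finset V) (hP : Fintype.card V < #P + d) (S : Finset V) (hS : ∃ e ∈ E, S ⊆ e) :
    ∃ e ∈ E, S ⊆ e ∧ e \ S ⊆ P := by
  induction hj : k - #S generalizing S with
  | zero =>
    obtain ⟨e, he, hSe⟩ := hS
    have : S = e := eq_of_subset_of_card_le hSe (by rw [hE e he]; omega)
    exact ⟨e, he, hSe, by simp [this]⟩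
  | succ j ih =>
    obtain ⟨e, he, hSe⟩ := hS
    have hlt : #S < #e := by rw [hE e he]; omega
    obtain ⟨x, hxe, hxS⟩ := exists_mem_notMem_of_card_lt_card hlt
    have hST : S ⊆ e.erase x := subset_erase.2 ⟨hSe, hxS⟩
    set T := e.erase x with hT
    have hTc : #T = k - 1 := by rw [card_erase_of_mem hxe, hE e he]
    have hdT := hd T hTc ⟨e, he, erase_subset _ _⟩
    let N : Finset V := {z | z ∉ T ∧ insert z T ∈ E}
    have hsub : {f ∈ E | T ⊆ f} ⊆ N.image fun z => insert z T := by
      intro f hf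
      obtain ⟨hfE, hTf⟩ := mem_filter.1 hf
      have h1 : #(f \ T) = 1 := by
        rw [card_sdiff_of_subset hTf, hE f hfE, hTc]
        omega
      obtain ⟨z, hz⟩ := card_eq_one.1 h1
      have hzf : insert z T = f := by
        rw [insert_eq, ← hz, sdiff_union_of_subset hTf]
      have hzT : z ∉ T := (mem_sdiff.1 (hz ▸ mem_singleton_self z)).2
      exact mem_image.2 ⟨z, by simp [N, hzT, hzf, hfE], hzf⟩
    have hN : d ≤ #N := hdT.trans ((card_le_card hsub).trans card_image_le)
    obtain ⟨z, hz⟩ := inter_nonempty_of_card_lt_card_add_card (subset_univ P) (subset_univ N)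
      (by rw [card_univ]; omega)
    obtain ⟨hzP, hzN⟩ := mem_inter.1 hz
    obtain ⟨hzT, hzE⟩ := (mem_filter.1 hzN).2
    have hzS : z ∉ S := fun h => hzT (hST h)
    obtain ⟨f, hf, hSf, hfP⟩ := ih (insert z S) ⟨_, hzE, insert_subset_insert z hST⟩
      (by rw [card_insert_of_notMem hzS]; omega)
    refine ⟨f, hf, (subset_insert z S).trans hSf, fun v hv => ?_⟩
    rw [mem_sdiff] at hv
    by_cases hvz : v = z
    · rwa [hvz]
    · exact hfP (mem_sdiff.2 ⟨hv.1, by simp [hvz, hv.2]⟩)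

/-- If every pair in `F` meets `B`, then `F` has at most `#B * #A` pairs inside `A`. -/
theorem card_pairs_le_mul {V : Type*} [DecidableEq V] (A B : Finset V)
    (F : Finset (Finset V)) (hF : F ⊆ A.powersetCard 2) (hB : ∀ p ∈ F, ∃ b ∈ B, b ∈ p) :
    #F ≤ #B * #A := by
  rw [← card_product]
  refine (card_le_card (t := (B ×ˢ A).image fun x => {x.1, x.2}) fun p hp => ?_).trans
    card_image_le
  obtain ⟨hpA, hp2⟩ := mem_powersetCard.1 (hF hp)
  obtain ⟨b, hbB, hbp⟩ := hB p hp
  obtain ⟨a, ha⟩ := card_eq_one.1 (show #(p.erase b) = 1 by rw [card_erase_of_mem hbp, hp2])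
  have hap : a ∈ p := mem_of_mem_erase (ha ▸ mem_singleton_self a)
  refine mem_image.2 ⟨(b, a), mem_product.2 ⟨hbB, hpA hap⟩, ?_⟩
  rw [← insert_erase hbp, ha]

/-- An edge has an ordering with a prescribed first vertex. -/
theorem exists_mem_orderedEdges {k n : ℕ} {E : Finset (Finset (Fin n))} {e : Finset (Fin n)}
    (he : e ∈ E) (hk : #e = k) (h0 : 0 < k) {u : Fin n} (hu : u ∈ e) :
    ∃ f ∈ orderedEdges k E, f ⟨0, h0⟩ = u ∧ image f univ = e := by
  let g := (e.equivFinOfCardEq hk).symm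
  let σ := (Equiv.swap ⟨0, h0⟩ (g.symm ⟨u, hu⟩)).trans g
  have himg : image (fun i => (σ i : Fin n)) univ = e := by
    ext v
    simp only [mem_image, mem_univ, true_and]
    constructor
    · rintro ⟨i, rfl⟩
      exact (σ i).2
    · intro hv
      exact ⟨σ.symm ⟨v, hv⟩, by simp⟩
  refine ⟨fun i => σ i, ?_, by simp [σ], himg⟩
  simp only [orderedEdges, mem_filter, mem_univ, true_and]
  exact ⟨Subtype.val_injective.comp σ.injective, by rwa [himg]⟩

/-- The number of vertices of smallest weight needed to meet every neighbourhood. -/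
theorem exists_threshold_index {k t n m : ℕ} {ε : ℝ} (ht : 2 ≤ t) (htk : t ≤ k)
    (hεk : ε * (4 * k * (k + 1)) ≤ 1) (hn : 1 ≤ ε * n) (hm : (n : ℝ) = t * m) :
    ∃ p : ℕ, (m : ℝ) + ε * n < p ∧ (p : ℝ) ≤ m + ε * n + 1 ∧
      (p : ℝ) * (t * k + 1) ≤ n * (k + 1) := by
  have htR : (2 : ℝ) ≤ t := by exact_mod_cast ht
  have htkR : (t : ℝ) ≤ k := by exact_mod_cast htk
  have h2m : 2 * (m : ℝ) ≤ n := by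
    rw [hm]
    gcongr
  have hεn : 0 ≤ ε * n := by linarith
  obtain ⟨p, hp⟩ : ∃ p, p = ⌊(m : ℝ) + ε * n⌋₊ + 1 := ⟨_, rfl⟩
  have hpl : (m : ℝ) + ε * n < p := by
    rw [hp]; push_cast; exact Nat.lt_floor_add_one _
  have hpu : (p : ℝ) ≤ m + ε * n + 1 := by
    rw [hp]; push_cast
    linarith [Nat.floor_le (show (0 : ℝ) ≤ m + ε * n by positivity)]
  have hpk : (p : ℝ) * (t * k + 1) ≤ n * (k + 1) := by
    have h1 : (p : ℝ) ≤ m + 2 * (ε * n) := by linarith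
    have h2 : (t * k + 1 : ℝ) ≤ k * (k + 1) := by nlinarith
    have h3 : ε * n * (t * k + 1) ≤ ε * n * (k * (k + 1)) := by gcongr
    have h4 : ε * (4 * k * (k + 1)) * n ≤ 1 * n := by gcongr
    calc (p : ℝ) * (t * k + 1) ≤ (m + 2 * (ε * n)) * (t * k + 1) := by gcongr
      _ = t * m * k + m + 2 * (ε * n * (t * k + 1)) := by ring
      _ ≤ n * (k + 1) := by rw [← hm]; linarith
  exact ⟨p, hpl, hpu, hpk⟩

/-- A vertex weighting that is nonnegative on every edge, however the edge is ordered, has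
nonnegative total. -/
theorem sum_nonneg_of_edge_weight_nonneg {k t n : ℕ} {ε : ℝ} (hk : 3 ≤ k) (ht : 2 ≤ t)
    (htk : t ≤ k) (hkt : k + 1 ≤ 2 * t) (hε : 0 < ε) (hεk : ε * (4 * k * (k + 1)) ≤ 1)
    (hn : 4 ≤ ε * n) (htn : t ∣ n) {E : Finset (Finset (Fin n))} (hE : ∀ e ∈ E, #e = k)
    (hiso : ∀ v, ∃ e ∈ E, v ∈ e)
    (hdeg : ∀ S : Finset (Fin n), #S = k - 1 → (∃ e ∈ E, S ⊆ e) →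
      (1 - 1 / (t : ℝ) - ε) * (n : ℝ) ≤ (#{e ∈ E | S ⊆ e} : ℝ))
    (hpairs : ∀ A : Finset (Fin n), (n : ℝ) / t ≤ #A →
      4 * ε * (n : ℝ) ^ 2 ≤ #{p ∈ A.powersetCard 2 | ∃ e ∈ E, p ⊆ e})
    (y : Fin n → ℝ)
    (hy : ∀ e ∈ E, ∀ u ∈ e, 0 ≤ (k - 1 : ℝ) * y u + (t - 1 : ℝ) * ∑ v ∈ e.erase u, y v) :
    0 ≤ ∑ v, y v := by
  have hkR : (3 : ℝ) ≤ k := by exact_mod_cast hk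
  have htR : (2 : ℝ) ≤ t := by exact_mod_cast ht
  have htkR : (t : ℝ) ≤ k := by exact_mod_cast htk
  have hktR : (k : ℝ) + 1 ≤ 2 * t := by exact_mod_cast hkt
  have hnR : (0 : ℝ) < n := by
    by_contra h
    nlinarith [(Nat.cast_nonneg n : (0 : ℝ) ≤ n)]
  have hn0 : 0 < n := by exact_mod_cast hnR
  have : Nonempty (Fin n) := ⟨⟨0, hn0⟩⟩
  by_contra! hneg
  obtain ⟨u₀, hu₀⟩ := Finite.exists_min y
  obtain ⟨M, hM⟩ : ∃ M, M = -y u₀ := ⟨_, rfl⟩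
  have hyM (v) : 0 ≤ y v + M := by linarith [hu₀ v]
  have hMpos : 0 < M := by
    by_contra h
    exact hneg.not_ge (sum_nonneg fun v _ => by linarith [hu₀ v])
  obtain ⟨m, hm⟩ := htn
  have hmR : (n : ℝ) = t * m := by exact_mod_cast hm
  obtain ⟨p, hpl, hpu, hpk⟩ := exists_threshold_index ht htk hεk (by linarith) hmR
  have hpn : (p : ℝ) < n := by
    by_contra! h
    have h1 : (k : ℝ) + 1 < t * k + 1 := by nlinarith
    nlinarith
  have hdeg' (S : Finset (Fin n)) (hS : #S = k - 1) (hSE : ∃ e ∈ E, S ⊆ e) :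
      ⌈(1 - 1 / (t : ℝ) - ε) * (n : ℝ)⌉₊ ≤ #{e ∈ E | S ⊆ e} :=
    Nat.ceil_le.2 (hdeg S hS hSE)
  obtain ⟨P, hPc, hPy⟩ := exists_lower_subset y p
    (by rw [Fintype.card_fin]; exact_mod_cast hpn.le)
  have hPd : Fintype.card (Fin n) < #P + ⌈(1 - 1 / (t : ℝ) - ε) * (n : ℝ)⌉₊ := by
    have h1 := Nat.le_ceil ((1 - 1 / (t : ℝ) - ε) * (n : ℝ))
    have h2 : (1 - 1 / (t : ℝ) - ε) * (n : ℝ) = n - m - ε * n := by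
      rw [hmR]; field_simp
    rw [Fintype.card_fin, hPc]
    rw [h2] at h1 ⊢
    have : (n : ℝ) < p + ⌈(n - m - ε * n : ℝ)⌉₊ := by linarith
    exact_mod_cast this
  have hext := exists_edge_sdiff_subset hE hdeg' P hPd
  have hp0 : 0 < p := by
    have : (0 : ℝ) < p := lt_of_le_of_lt (by positivity) hpl
    exact_mod_cast this
  obtain ⟨w, hwP, hwmax⟩ := exists_max_image P y (card_pos.1 (hPc ▸ hp0))
  set c := y w with hc
  have hsum (S : Finset (Fin n)) (hS : S ⊆ P) : ∑ v ∈ S, y v ≤ #S * c := by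
    rw [← nsmul_eq_mul]
    exact sum_le_card_nsmul _ _ _ fun v hv => hwmax v (hS hv)
  have hcM : M ≤ (t - 1) * c := by
    obtain ⟨e, he, hue, heP⟩ := hext {u₀} (by simpa using hiso u₀)
    have hu : u₀ ∈ e := singleton_subset_iff.1 hue
    rw [sdiff_singleton_eq_erase] at heP
    have h1 := hsum _ heP
    rw [card_erase_of_mem hu, hE e he, Nat.cast_sub (by omega), Nat.cast_one] at h1
    have h2 := hy e he u₀ hu
    have h3 : (t - 1 : ℝ) * ∑ v ∈ e.erase u₀, y v ≤ (t - 1) * ((k - 1) * c) :=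
      mul_le_mul_of_nonneg_left h1 (by linarith)
    nlinarith
  have hcompl : (n - p : ℝ) * c ≤ ∑ v ∈ Pᶜ, y v := by
    have h1 : #Pᶜ • c ≤ ∑ v ∈ Pᶜ, y v :=
      card_nsmul_le_sum _ _ _ fun v hv => hPy w hwP v (mem_compl.1 hv)
    rwa [nsmul_eq_mul, card_compl, Fintype.card_fin, hPc,
      Nat.cast_sub (by exact_mod_cast hpn.le)] at h1
  have hX : ∑ v ∈ P, (y v + M) < p * M - (n - p) * c := by
    rw [sum_add_distrib, sum_const, hPc, nsmul_eq_mul]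
    linarith [sum_add_sum_compl P y]
  have hX0 : 0 ≤ ∑ v ∈ P, (y v + M) := sum_nonneg fun v _ => hyM v
  have hcu : k * (t - 1) * c ≤ (k + 1) * M := by
    have h1 : (n - p) * c ≤ p * M := by linarith
    have h2 : (k * (t - 1) : ℝ) * ((n - p) * c) ≤ k * (t - 1) * (p * M) :=
      mul_le_mul_of_nonneg_left h1 (mul_nonneg (by linarith) (by linarith))
    have h3 : (p : ℝ) * (t * k + 1) * M ≤ n * (k + 1) * M := by gcongr
    refine le_of_mul_le_mul_left ?_ (sub_pos.2 hpn)
    linarith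
  have hXt : (t - 1) * ∑ v ∈ P, (y v + M) ≤ M * t * (ε * n + 1) := by
    have h1 : (t - 1) * ∑ v ∈ P, (y v + M) ≤ (t - 1) * (p * M - (n - p) * c) :=
      mul_le_mul_of_nonneg_left hX.le (by linarith)
    have h2 : (n - p) * M ≤ (n - p) * ((t - 1) * c) :=
      mul_le_mul_of_nonneg_left hcM (by linarith)
    have h3 : M * t * p ≤ M * t * (m + ε * n + 1) := by gcongr
    have h4 : M * n = M * t * m := by rw [hmR]; ring
    linarith
  obtain ⟨A, hAP, hAc⟩ := exists_subset_card_eq (s := P) (n := m) (by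
    rw [hPc]
    have : (m : ℝ) ≤ p := by linarith [mul_pos hε hnR]
    exact_mod_cast this)
  let B : Finset (Fin n) := {v ∈ A | -(2 / 3) * M < y v}
  have hBA : B ⊆ A := filter_subset _ _
  have hmeet : ∀ q ∈ ({q ∈ A.powersetCard 2 | ∃ e ∈ E, q ⊆ e} : Finset _), ∃ b ∈ B, b ∈ q := by
    intro q hq
    obtain ⟨hq1, hqE⟩ := mem_filter.1 hq
    obtain ⟨hqA, hq2⟩ := mem_powersetCard.1 hq1
    by_contra! hqB
    have hlow (v) (hv : v ∈ q) : y v ≤ -(2 / 3) * M := by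
      by_contra! h
      exact hqB v (mem_filter.2 ⟨hqA hv, h⟩) hv
    obtain ⟨e, he, hqe, heP⟩ := hext q hqE
    obtain ⟨u, v, huv, rfl⟩ := card_eq_two.1 hq2
    have hu : u ∈ e := hqe (by simp)
    have hv : v ∈ e.erase u := mem_erase.2 ⟨huv.symm, hqe (by simp)⟩
    have hrest : (e.erase u).erase v ⊆ P := fun x hx => heP (by
      simp only [mem_erase] at hx
      simp [hx])
    have h1 := hsum _ hrest
    rw [card_erase_of_mem hv, card_erase_of_mem hu, hE e he, Nat.sub_sub,
      Nat.cast_sub (by omega)] at h1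
    have h2 := hy e he u hu
    rw [← add_sum_erase _ _ hv] at h2
    have h3 : (k - 1 : ℝ) * y u ≤ (k - 1) * (-(2 / 3) * M) :=
      mul_le_mul_of_nonneg_left (hlow u (by simp)) (by linarith)
    have h4 : (t - 1 : ℝ) * (y v + ∑ x ∈ (e.erase u).erase v, y x)
        ≤ (t - 1) * (-(2 / 3) * M + (k - 2) * c) := by
      refine mul_le_mul_of_nonneg_left (add_le_add (hlow v (by simp)) ?_) (by linarith)
      norm_num at h1
      exact h1
    have h5 : (k - 2 : ℝ) * (k * (t - 1) * c) ≤ (k - 2) * ((k + 1) * M) :=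
      mul_le_mul_of_nonneg_left hcu (by linarith)
    have h6 : 0 ≤ (k : ℝ) * ((k - 1) * (-(2 / 3) * M) + (t - 1) * (-(2 / 3) * M + (k - 2) * c)) :=
      mul_nonneg (by linarith) (by linarith)
    have h7 : (k : ℝ) * M * (k + 1) ≤ k * M * (2 * t) := by gcongr
    linarith [mul_pos (show (0 : ℝ) < k by linarith) hMpos]
  have hcount : 4 * ε * (n : ℝ) ^ 2 ≤ #B * m := by
    refine (hpairs A (by rw [hAc, hmR]; field_simp; rfl)).trans ?_
    rw [← hAc]
    exact_mod_cast card_pairs_le_mul A B _ (filter_subset _ _) hmeet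
  have hBX : (#B : ℝ) * (M / 3) ≤ ∑ v ∈ P, (y v + M) := by
    rw [← nsmul_eq_mul]
    calc #B • (M / 3) ≤ ∑ v ∈ B, (y v + M) :=
          card_nsmul_le_sum _ _ _ fun v hv => by linarith [(mem_filter.1 hv).2]
      _ ≤ _ := sum_le_sum_of_subset_of_nonneg (hBA.trans hAP) fun v _ _ => hyM v
  have hBt : (t - 1 : ℝ) * #B ≤ 3 * t * (ε * n + 1) := by
    have h1 : (t - 1 : ℝ) * (#B * (M / 3)) ≤ (t - 1) * ∑ v ∈ P, (y v + M) :=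
      mul_le_mul_of_nonneg_left hBX (by linarith)
    refine le_of_mul_le_mul_left ?_ hMpos
    linarith
  have h1 : (t - 1 : ℝ) * #B * m ≤ 3 * t * (ε * n + 1) * m := by gcongr
  have h2 : (t - 1 : ℝ) * (4 * ε * n ^ 2) ≤ (t - 1) * (#B * m) :=
    mul_le_mul_of_nonneg_left hcount (by linarith)
  have h3 : 4 * ε * (n : ℝ) ^ 2 ≤ (t - 1) * (4 * ε * n ^ 2) :=
    le_mul_of_one_le_left (by positivity) (by linarith)
  have h4 : 4 * ε * (n : ℝ) ^ 2 ≤ 3 * n * (ε * n + 1) := by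
    calc _ ≤ 3 * t * (ε * n + 1) * m := by linarith
      _ = 3 * (t * m) * (ε * n + 1) := by ring
      _ = _ := by rw [← hmR]
  linarith [mul_le_mul_of_nonneg_left hn hnR.le]

/-- Non-extremal `k`-graphs (with `t ∣ n` and pair-density constant `4ε`)
have a `w*`-weighted perfect fractional matching, where `w* = (k-1, t-1, …, t-1)`. -/
theorem weighted_perfect_fractional_matching_t_dvd
    (k l t : ℕ) (hk : 3 ≤ k) (hl : 1 ≤ l) (hlk : l ≤ k - 1)
    (ht : t = k / (k - l) * (k - l)) :
    ∃ ε₀ : ℝ, 0 < ε₀ ∧ ∀ ε : ℝ, 0 < ε → ε ≤ ε₀ →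
    ∃ n₀ : ℕ, ∀ n : ℕ, n₀ ≤ n → t ∣ n →
    ∀ E : Finset (Finset (Fin n)),
      (∀ e ∈ E, e.card = k) →
      (∀ v : Fin n, ∃ e ∈ E, v ∈ e) →
      (∀ S : Finset (Fin n), S.card = k - 1 → (∃ e ∈ E, S ⊆ e) →
        (1 - 1 / (t : ℝ) - ε) * (n : ℝ) ≤ ((E.filter fun e => S ⊆ e).card : ℝ)) →
      (∀ A : Finset (Fin n), (n : ℝ) / (t : ℝ) ≤ (A.card : ℝ) →
        4 * ε * (n : ℝ) ^ 2 ≤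
          (((A.powersetCard 2).filter fun p => ∃ e ∈ E, p ⊆ e).card : ℝ)) →
      ∃ q : (Fin k → Fin n) → ℝ,
        (∀ e ∈ orderedEdges k E, 0 ≤ q e) ∧
        ∀ v : Fin n,
          ∑ i : Fin k, ∑ e ∈ (orderedEdges k E).filter (fun e => e i = v),
            (if (i : ℕ) = 0 then (k : ℝ) - 1 else (t : ℝ) - 1) * q e = 1 := by
  have hq : 1 ≤ k / (k - l) := (Nat.one_le_div_iff (by omega)).2 (by omega)
  have htk : t ≤ k := ht ▸ Nat.div_mul_le_self k (k - l)
  have hkt : k + 1 ≤ 2 * t := by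
    have h1 := Nat.div_add_mod' k (k - l)
    have h2 := Nat.mod_lt k (show 0 < k - l by omega)
    have h3 : k - l ≤ t := ht ▸ Nat.le_mul_of_pos_left _ hq
    omega
  have hkR : (3 : ℝ) ≤ k := by exact_mod_cast hk
  have htR : (2 : ℝ) ≤ t := by exact_mod_cast (show 2 ≤ t by omega)
  refine ⟨1 / (4 * k * (k + 1)), by positivity, fun ε hε hεk =>
    ⟨⌈4 / ε⌉₊, fun n hn htn E hE hiso hdeg hpairs => ?_⟩⟩
  have hn4 : 4 ≤ ε * n := by
    have := (Nat.le_ceil (4 / ε)).trans (Nat.cast_le.2 hn)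
    rwa [div_le_iff₀' hε] at this
  have hn0 : 0 < n := by
    rcases Nat.eq_zero_or_pos n with rfl | h
    · norm_num at hn4
    · exact h
  have : Nonempty (Fin n) := ⟨⟨0, hn0⟩⟩
  let wt : Fin k → ℝ := fun i => if (i : ℕ) = 0 then (k : ℝ) - 1 else (t : ℝ) - 1
  have hwt (i : Fin k) : 0 < wt i := by
    dsimp only [wt]
    split_ifs <;> linarith
  have hsplit (f : Fin k → Fin n) (y : Fin n → ℝ) :
      ∑ v, (∑ i, if f i = v then wt i else 0) * y v = ∑ i, wt i * y (f i) := by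
    simp only [sum_mul, ite_mul, zero_mul]
    rw [sum_comm]
    simp
  obtain ⟨q, hq0, hq1⟩ := exists_nonneg_combination_eq_one
    (fun (f : orderedEdges k E) v => ∑ i, if f.1 i = v then wt i else 0) (∑ i, wt i)
    (sum_pos (fun i _ => hwt i) ⟨⟨0, by omega⟩, mem_univ _⟩)
    (fun f => by simpa using hsplit f.1 fun _ => 1) (fun y hy => by
      refine sum_nonneg_of_edge_weight_nonneg hk (by omega) htk hkt hε
        ((le_div_iff₀ (by positivity)).1 hεk) hn4 htn hE hiso hdeg hpairs y fun e he u hu => ?_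
      obtain ⟨f, hf, hfu, hfe⟩ := exists_mem_orderedEdges he (hE e he) (by omega) hu
      have hinj : Function.Injective f := (mem_filter.1 hf).2.1
      have h1 := hy ⟨f, hf⟩
      rw [hsplit] at h1
      dsimp only at h1
      have h2 : ∑ v ∈ e.erase u, y v = ∑ i ∈ univ.erase ⟨0, by omega⟩, y (f i) := by
        rw [← hfe, ← hfu, ← image_erase hinj, sum_image hinj.injOn]
      rw [← add_sum_erase univ (fun i => wt i * y (f i)) (mem_univ (⟨0, by omega⟩ : Fin k)),
        hfu] at h1
      have h3 : ∑ i ∈ univ.erase ⟨0, by omega⟩, (t - 1 : ℝ) * y (f i) =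
          ∑ i ∈ univ.erase ⟨0, by omega⟩, wt i * y (f i) := by
        refine sum_congr rfl fun i hi => ?_
        have hi0 : (i : ℕ) ≠ 0 := fun h => ne_of_mem_erase hi (Fin.ext h)
        simp [wt, hi0]
      have h4 : wt ⟨0, by omega⟩ = (k : ℝ) - 1 := if_pos rfl
      rw [h2, mul_sum, h3, ← h4]
      exact h1.le)
  refine ⟨fun f => if hf : f ∈ orderedEdges k E then q ⟨f, hf⟩ else 0, fun f hf => ?_, fun v => ?_⟩
  · simpa [hf] using hq0 ⟨f, hf⟩
  · refine Eq.trans ?_ (hq1 v)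
    simp only [sum_filter, mul_sum]
    rw [sum_comm, ← sum_coe_sort]
    refine sum_congr rfl fun f _ => sum_congr rfl fun i _ => ?_
    simp [wt, mul_comm]
end

section
/- Let k ≥ 3, ℓ ∈ [k−1], and t = ⌊k/(k−ℓ)⌋·(k−ℓ). Let H be a complete k-partite k-graph on r vertices with parts A, B_1, …, B_{k−1}, where r ≥ 1 is divisible by t(k−1), |A| = r/t, and |B_i| = r(t−1)/(t(k−1)) for all i ∈ [k−1]. Then H contains a spanning ℓ-cycle which contains an ordered edge whose k vertices, in order, lie in B_1, …, B_{t−1}, A, B_t, …, B_{k−1} respectively. -/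
open Finset

/-- The number of `m < n` with `m % t ≠ t - 1`, provided `n % t ≠ t - 1`. -/
def offRank (t n : ℕ) : ℕ := n / t * (t - 1) + n % t

/-- The part of the `n`-th vertex of the cycle: the last vertex of each block of length `t` has
label `k - 1`, and the remaining vertices are labelled cyclically by `0, …, k - 2`. -/
def partLabel (k t n : ℕ) : ℕ := if n % t = t - 1 then k - 1 else offRank t n % (k - 1)

/-- The position of the `n`-th vertex of the cycle among those with the same label. -/
def partRank (k t n : ℕ) : ℕ := if n % t = t - 1 then n / t else offRank t n / (k - 1)

lemma partLabel_eq_sub_one_iff {k t n : ℕ} (hk : 2 ≤ k) :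
    partLabel k t n = k - 1 ↔ n % t = t - 1 := by
  unfold partLabel
  split_ifs with h
  · simp [h]
  · have := Nat.mod_lt (offRank t n) (show k - 1 > 0 by omega)
    simp only [h, iff_false]
    omega

lemma partLabel_lt {k t n : ℕ} (hk : 2 ≤ k) : partLabel k t n < k := by
  unfold partLabel
  split_ifs
  · omega
  · have := Nat.mod_lt (offRank t n) (show k - 1 > 0 by omega)
    omega

lemma partLabel_add_mul (k t n m : ℕ) (ht : 0 < t) :
    partLabel k t (n + t * (k - 1) * m) = partLabel k t n := by
  have h1 : (n + t * (k - 1) * m) % t = n % t := by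
    rw [mul_assoc, Nat.add_mul_mod_self_left]
  have h2 : (n + t * (k - 1) * m) / t = n / t + (k - 1) * m := by
    rw [mul_assoc, Nat.add_mul_div_left _ _ ht]
  unfold partLabel offRank
  rw [h1, h2, show (n / t + (k - 1) * m) * (t - 1) + n % t =
    n / t * (t - 1) + n % t + (k - 1) * (m * (t - 1)) by ring, Nat.add_mul_mod_self_left]

lemma partLabel_mod {k t r : ℕ} (ht : 0 < t) (h : t * (k - 1) ∣ r) (n : ℕ) :
    partLabel k t (n % r) = partLabel k t n := by
  obtain ⟨c, rfl⟩ := h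
  conv_rhs => rw [← Nat.mod_add_div n (t * (k - 1) * c), mul_assoc _ c,
    partLabel_add_mul _ _ _ _ ht]

lemma offRank_injOn {t n m : ℕ} (ht : 2 ≤ t) (hn : n % t ≠ t - 1) (hm : m % t ≠ t - 1)
    (h : offRank t n = offRank t m) : n = m := by
  have h1 := Nat.mod_lt n (show t > 0 by omega)
  have h2 := Nat.mod_lt m (show t > 0 by omega)
  unfold offRank at h
  have hmod : n % t = m % t := by
    have := congrArg (· % (t - 1)) h
    simpa [Nat.mul_add_mod_self_right, Nat.mod_eq_of_lt (show n % t < t - 1 by omega),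
      Nat.mod_eq_of_lt (show m % t < t - 1 by omega)] using this
  have hdiv : n / t = m / t :=
    Nat.eq_of_mul_eq_mul_right (show 0 < t - 1 by omega) (by omega)
  rw [← Nat.div_add_mod n t, ← Nat.div_add_mod m t, hmod, hdiv]

lemma partLabel_partRank_injective {k t n m : ℕ} (hk : 2 ≤ k) (ht : 2 ≤ t)
    (hl : partLabel k t n = partLabel k t m) (hr : partRank k t n = partRank k t m) : n = m := by
  have hiff : n % t = t - 1 ↔ m % t = t - 1 := by
    rw [← partLabel_eq_sub_one_iff hk, ← partLabel_eq_sub_one_iff hk, hl]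
  by_cases hn : n % t = t - 1
  · have hm := hiff.1 hn
    simp only [partRank, hn, hm, if_true] at hr
    rw [← Nat.div_add_mod n t, ← Nat.div_add_mod m t, hn, hm, hr]
  · have hm : m % t ≠ t - 1 := fun h => hn (hiff.2 h)
    simp only [partRank, partLabel, hn, hm, if_false] at hr hl
    apply offRank_injOn ht hn hm
    rw [← Nat.div_add_mod (offRank t n) (k - 1), ← Nat.div_add_mod (offRank t m) (k - 1), hl, hr]

lemma partLabel_injective_window {k d t i j j' : ℕ} (hk : 3 ≤ k) (ht : 2 ≤ t) (hdt : d ∣ t)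
    (htk : t ≤ k) (hktd : k < t + d) (hjj : j < j') (hj' : j' < k) :
    partLabel k t (i * d + j) ≠ partLabel k t (i * d + j') := by
  intro h
  have hdle : d ≤ t := Nat.le_of_dvd (by omega) hdt
  have hiff : (i * d + j) % t = t - 1 ↔ (i * d + j') % t = t - 1 := by
    rw [← partLabel_eq_sub_one_iff (k := k) (by omega),
      ← partLabel_eq_sub_one_iff (k := k) (by omega), h]
  obtain ⟨n, hn⟩ : ∃ n, n = i * d + j := ⟨_, rfl⟩
  obtain ⟨m, hm⟩ : ∃ m, m = i * d + j' := ⟨_, rfl⟩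
  rw [← hn, ← hm] at hiff h
  have en := Nat.div_add_mod n t
  have em := Nat.div_add_mod m t
  have ln := Nat.mod_lt n (show t > 0 by omega)
  have lm := Nat.mod_lt m (show t > 0 by omega)
  have hle : n / t ≤ m / t := Nat.div_le_div_right (by omega)
  obtain ⟨s, hs⟩ := Nat.exists_eq_add_of_le hle
  have hs2 : s < 3 := by
    by_contra hs3
    have : t * 3 ≤ t * s := Nat.mul_le_mul_left t (by omega)
    rw [hs, mul_add] at em
    omega
  rw [hs, mul_add] at em
  by_cases hnA : n % t = t - 1
  · have hmA := hiff.1 hnA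
    have hs1 : s = 1 := by interval_cases s <;> omega
    have hdvd : d ∣ i * d + (j + 1) := by
      have : i * d + (j + 1) = t * (n / t + 1) := by rw [mul_add]; omega
      rw [this]
      exact hdt.mul_right _
    have := Nat.le_of_dvd (by omega) ((Nat.dvd_add_right (dvd_mul_left d i)).1 hdvd)
    rw [hs1] at em
    omega
  · have hmA : m % t ≠ t - 1 := fun h => hnA (hiff.2 h)
    simp only [partLabel, hnA, hmA, if_false] at h
    have hdiff : offRank t m + s + (n % t) = offRank t n + t * s + m % t := by
      unfold offRank
      obtain ⟨u, rfl⟩ : ∃ u, t = u + 1 := ⟨t - 1, by omega⟩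
      rw [hs, Nat.add_sub_cancel]
      ring
    have hlt : offRank t n < offRank t m ∧ offRank t m < offRank t n + (k - 1) := by
      interval_cases s <;> omega
    have := (Nat.modEq_iff_dvd' hlt.1.le).1 h
    have := Nat.le_of_dvd (by omega) this
    omega

lemma partLabel_of_lt {k t j : ℕ} (htk : t ≤ k) (hk2 : k < 2 * t) (hj : j < k) :
    partLabel k t j = if j < t - 1 then j else if j = t - 1 then k - 1 else j - 1 := by
  unfold partLabel offRank
  rcases lt_or_ge j t with h | h
  · rw [Nat.mod_eq_of_lt h, Nat.div_eq_of_lt h, zero_mul, zero_add]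
    split_ifs <;> first | omega | exact Nat.mod_eq_of_lt (by omega)
  · have h1 : j / t = 1 := by
      rw [Nat.div_eq_iff (by omega)]; omega
    have h2 : j % t = j - t := by
      rw [Nat.mod_eq_sub_mod h, Nat.mod_eq_of_lt (by omega)]
    rw [h1, h2, one_mul, if_neg (by omega), if_neg (by omega), if_neg (by omega),
      Nat.mod_eq_of_lt (by omega)]
    omega

lemma offRank_lt {t a n : ℕ} (ht : 2 ≤ t) (hn : n < t * a) (hA : n % t ≠ t - 1) :
    offRank t n < a * (t - 1) := by
  have h1 := Nat.mod_lt n (show t > 0 by omega)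
  have h2 : n / t < a := Nat.div_lt_of_lt_mul hn
  have h3 : (n / t + 1) * (t - 1) ≤ a * (t - 1) := Nat.mul_le_mul_right _ h2
  unfold offRank
  rw [add_mul] at h3
  omega

/-- An assignment of labels and ranks to positions that is jointly injective, with ranks bounded by
the sizes of pairwise disjoint parts, is realised by an injection into the parts. -/
lemma exists_injective_mem_parts {α β ι : Type*} (P : ι → Finset β) (lab : α → ι) (rank : α → ℕ)
    (hdisj : ∀ x y, lab x ≠ lab y → Disjoint (P (lab x)) (P (lab y)))
    (hinj : ∀ x y, lab x = lab y → rank x = rank y → x = y)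
    (hrank : ∀ x, rank x < (P (lab x)).card) :
    ∃ f : α → β, Function.Injective f ∧ ∀ x, f x ∈ P (lab x) := by
  have key : ∀ (s s' : Finset β) (a b : ℕ) (ha : a < s.card) (hb : b < s'.card), s = s' →
      (s.equivFin.symm ⟨a, ha⟩ : β) = s'.equivFin.symm ⟨b, hb⟩ → a = b := by
    rintro s _ a b ha hb rfl h
    simpa using s.equivFin.symm.injective (Subtype.ext h)
  refine ⟨fun x => (P (lab x)).equivFin.symm ⟨rank x, hrank x⟩, ?_, fun x => Subtype.coe_prop _⟩
  intro x y hxy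
  replace hxy : ((P (lab x)).equivFin.symm ⟨rank x, hrank x⟩ : β) =
    (P (lab y)).equivFin.symm ⟨rank y, hrank y⟩ := hxy
  have hl : lab x = lab y := by
    by_contra hne
    refine Finset.disjoint_left.1 (hdisj x y hne)
      (Subtype.coe_prop ((P (lab x)).equivFin.symm ⟨rank x, hrank x⟩)) ?_
    rw [hxy]
    exact Subtype.coe_prop _
  exact hinj x y hl (key _ _ _ _ _ _ (congrArg P hl) hxy)

/-- A `k`-tuple whose entries lie in distinct parts meets each of the `k` parts exactly once. -/
lemma card_image_inter_part {β : Type*} [DecidableEq β] {k : ℕ} (P : ℕ → Finset β)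
    (hdisj : ∀ a < k, ∀ b < k, a ≠ b → Disjoint (P a) (P b)) (lab : Fin k → ℕ)
    (hlab : ∀ j, lab j < k) (hinj : Function.Injective lab) (g : Fin k → β)
    (hg : ∀ j, g j ∈ P (lab j)) (c : ℕ) (hc : c < k) :
    (Finset.univ.image g ∩ P c).card = 1 := by
  have hsurj : Function.Surjective (fun j => (⟨lab j, hlab j⟩ : Fin k)) :=
    Finite.surjective_of_injective fun a b h => hinj (congrArg Fin.val h)
  obtain ⟨j, hj⟩ := hsurj ⟨c, hc⟩
  have hjc : lab j = c := congrArg Fin.val hj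
  rw [Finset.card_eq_one]
  refine ⟨g j, Finset.eq_singleton_iff_unique_mem.2 ⟨?_, ?_⟩⟩
  · exact Finset.mem_inter.2 ⟨Finset.mem_image_of_mem g (Finset.mem_univ j), hjc ▸ hg j⟩
  · intro x hx
    obtain ⟨hx1, hx2⟩ := Finset.mem_inter.1 hx
    obtain ⟨j', -, rfl⟩ := Finset.mem_image.1 hx1
    by_contra hne
    have hlne : lab j' ≠ c := fun h => hne (congrArg g (hinj (h.trans hjc.symm)))
    exact Finset.disjoint_left.1 (hdisj _ (hlab j') c hc hlne) (hg j') hx2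

/-- A complete `k`-partite `k`-graph on `r` vertices with parts
`A, B_1, …, B_{k-1}` of sizes `r/t` and `r(t-1)/(t(k-1))` respectively (where
`t(k-1) ∣ r`) has a spanning ℓ-cycle containing an ordered edge whose vertices
lie, in order, in `B_1, …, B_{t-1}, A, B_t, …, B_{k-1}`.

The parts are `PA` (the part `A`) and `Bs 0, …, Bs (k-2)` (the parts
`B_1, …, B_{k-1}`); the spanning ℓ-cycle is given by a cyclic ordering
`f : ZMod r → Fin r` of the vertices. -/
theorem spanning_ell_cycle_in_complete_k_partite
    (k l t r : ℕ) (hk : 3 ≤ k) (hl : 1 ≤ l) (hlk : l ≤ k - 1)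
    (ht : t = k / (k - l) * (k - l)) (hr1 : 1 ≤ r) (hrd : t * (k - 1) ∣ r)
    (PA : Finset (Fin r)) (Bs : ℕ → Finset (Fin r))
    (hcover : PA ∪ (Finset.range (k - 1)).biUnion Bs = Finset.univ)
    (hdisj1 : ∀ i < k - 1, Disjoint PA (Bs i))
    (hdisj2 : ∀ i < k - 1, ∀ j < k - 1, i ≠ j → Disjoint (Bs i) (Bs j))
    (hA : t * PA.card = r)
    (hB : ∀ i < k - 1, t * (k - 1) * (Bs i).card = r * (t - 1))
    (E : Finset (Finset (Fin r)))
    (hE : ∀ e : Finset (Fin r),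
      e ∈ E ↔ ((e ∩ PA).card = 1 ∧ ∀ i < k - 1, (e ∩ Bs i).card = 1)) :
    ∃ f : ZMod r → Fin r, Function.Bijective f ∧
      (∀ i : ℕ,
        (Finset.image (fun j : Fin k => f (((i * (k - l) + (j : ℕ)) : ℕ) : ZMod r))
          Finset.univ) ∈ E) ∧
      ∃ i₀ : ℕ, ∀ j : Fin k,
        f (((i₀ * (k - l) + (j : ℕ)) : ℕ) : ZMod r) ∈
          (if (j : ℕ) < t - 1 then Bs (j : ℕ)
           else if (j : ℕ) = t - 1 then PA
           else Bs ((j : ℕ) - 1)) := by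
  have hd0 : 0 < k - l := by omega
  obtain ⟨d, hd⟩ : ∃ d, d = k - l := ⟨_, rfl⟩
  rw [← hd] at ht hd0 ⊢
  have hq : 1 ≤ k / d := Nat.div_pos (by omega) hd0
  have hdt : d ∣ t := ht ▸ dvd_mul_left d _
  have hdm := Nat.div_add_mod k d
  rw [mul_comm, ← ht] at hdm
  have hmod := Nat.mod_lt k hd0
  have htk : t ≤ k := by omega
  have hktd : k < t + d := by omega
  have hdle : d ≤ t := by rw [ht]; exact Nat.le_mul_of_pos_left d hq
  have ht2 : 2 ≤ t := by omega
  have : NeZero r := ⟨by omega⟩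
  let P : ℕ → Finset (Fin r) := fun c => if c = k - 1 then PA else Bs c
  have hP : ∀ c < k - 1, P c = Bs c := fun c hc => if_neg hc.ne
  have hPA : P (k - 1) = PA := if_pos rfl
  have hPdisj : ∀ a < k, ∀ b < k, a ≠ b → Disjoint (P a) (P b) := by
    intro a ha b hb hab
    by_cases h1 : a = k - 1
    · rw [h1, hPA, hP b (by omega)]
      exact hdisj1 b (by omega)
    · by_cases h2 : b = k - 1
      · rw [h2, hPA, hP a (by omega)]
        exact (hdisj1 a (by omega)).symm
      · rw [hP a (by omega), hP b (by omega)]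
        exact hdisj2 a (by omega) b (by omega) hab
  have hrank : ∀ n < r, partRank k t n < (P (partLabel k t n)).card := by
    intro n hn
    have hnA : n < t * PA.card := hA.symm ▸ hn
    by_cases h : n % t = t - 1
    · rw [(partLabel_eq_sub_one_iff (by omega)).2 h, hPA, partRank, if_pos h]
      exact Nat.div_lt_of_lt_mul hnA
    · have hlt : partLabel k t n < k - 1 := by
        rw [partLabel, if_neg h]
        exact Nat.mod_lt _ (by omega)
      rw [hP _ hlt, partRank, if_neg h]
      refine Nat.div_lt_of_lt_mul ((offRank_lt ht2 hnA h).trans_eq ?_)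
      refine Nat.eq_of_mul_eq_mul_left (show 0 < t by omega) ?_
      rw [← mul_assoc, ← mul_assoc, hA, hB _ hlt]
  obtain ⟨f, hf, hfP⟩ := exists_injective_mem_parts P
    (fun x : ZMod r => partLabel k t x.val) (fun x : ZMod r => partRank k t x.val)
    (fun x y h => hPdisj _ (partLabel_lt (by omega)) _ (partLabel_lt (by omega)) h)
    (fun x y h1 h2 => ZMod.val_injective r
      (partLabel_partRank_injective (by omega) ht2 h1 h2))
    (fun x => hrank _ (ZMod.val_lt x))
  have hfn : ∀ n : ℕ, f (n : ZMod r) ∈ P (partLabel k t n) := by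
    intro n
    have := hfP (n : ZMod r)
    rwa [ZMod.val_natCast, partLabel_mod (by omega) hrd] at this
  refine ⟨f, (Fintype.bijective_iff_injective_and_card f).2 ⟨hf, by simp [ZMod.card]⟩, ?_, 0, ?_⟩
  · intro i
    have hinj : Function.Injective fun j : Fin k => partLabel k t (i * d + j) := by
      intro a b hab
      rcases lt_trichotomy (a : ℕ) b with h | h | h
      · exact absurd hab (partLabel_injective_window hk ht2 hdt htk hktd h b.2)
      · exact Fin.ext h
      · exact absurd hab.symm (partLabel_injective_window hk ht2 hdt htk hktd h a.2)
    have hcard := card_image_inter_part P hPdisj (fun j : Fin k => partLabel k t (i * d + j))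
      (fun _ => partLabel_lt (by omega)) hinj
      (fun j : Fin k => f (((i * d + (j : ℕ)) : ℕ) : ZMod r)) (fun _ => hfn _)
    refine (hE _).2 ⟨?_, fun c hc => ?_⟩
    · rw [← hPA]
      exact hcard (k - 1) (by omega)
    · rw [← hP c hc]
      exact hcard c (by omega)
  · intro j
    have hj := hfn (0 * d + j)
    have hjk := j.2
    rw [show partLabel k t (0 * d + j) = partLabel k t j by rw [zero_mul, zero_add],
      partLabel_of_lt htk (by omega) hjk] at hj
    split_ifs at hj ⊢ with h1 h2
    · rwa [hP _ (by omega)] at hj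
    · rwa [hPA] at hj
    · rwa [hP _ (by omega)] at hj
end

section
/- Let k ≥ 3 and let G be an n-vertex k-graph with δ*(G) > n/2, no isolated vertices, and n ≥ 4k. Let S = u_1…u_s and T = v_1…v_{t'} be ordered supported sets with s, t' ∈ [k]. Then G contains a tight walk whose first s vertices are u_1…u_s in order and whose last t' vertices are v_1…v_{t'} in order, and which has at least k vertices strictly between these two segments (i.e., its order is at least s + t' + k). -/
open Finset

section TightWalk

variable {V : Type*} [DecidableEq V] {E : Finset (Finset V)} {k : ℕ}

/-- Two `(k-1)`-sets, each lying in more than half of `|V|` edges, extend to edges by a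
common vertex. -/
lemma exists_common_extension [Fintype V] (hE : ∀ e ∈ E, e.card = k) {A B : Finset V}
    (hA : A.card + 1 = k) (hB : B.card + 1 = k)
    (hAd : Fintype.card V < 2 * (E.filter fun e => A ⊆ e).card)
    (hBd : Fintype.card V < 2 * (E.filter fun e => B ⊆ e).card) :
    ∃ x, insert x A ∈ E ∧ insert x B ∈ E := by
  have key : ∀ C : Finset V, C.card + 1 = k →
      (E.filter fun e => C ⊆ e).card ≤ (univ.filter fun x => insert x C ∈ E).card := by
    intro C hC
    refine (card_le_card ?_).trans (card_image_le (f := fun x => insert x C))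
    intro e he
    obtain ⟨heE, hCe⟩ := mem_filter.mp he
    have hlt : C.card < e.card := by rw [hE e heE]; omega
    obtain ⟨x, hxe, hxC⟩ := exists_mem_notMem_of_card_lt_card hlt
    have heq : insert x C = e := by
      refine eq_of_subset_of_card_le (insert_subset hxe hCe) ?_
      rw [card_insert_of_notMem hxC, hE e heE, hC]
    exact mem_image.mpr ⟨x, by simp [heq, heE], heq⟩
  obtain ⟨x, hx⟩ := inter_nonempty_of_card_lt_card_add_card
    (subset_univ (univ.filter fun x => insert x A ∈ E))
    (subset_univ (univ.filter fun x => insert x B ∈ E))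
    (by have := key A hA; have := key B hB; rw [card_univ]; omega)
  simp only [mem_inter, mem_filter, mem_univ, true_and] at hx
  exact ⟨x, hx⟩

lemma image_update_range (f : ℕ → V) {i : ℕ} (hi : i < k) (x : V) :
    (range k).image (Function.update f i x) = insert x (((range k).erase i).image f) := by
  rw [← insert_erase (mem_range.mpr hi), image_insert, erase_insert (notMem_erase _ _)]
  simp only [Function.update_self]
  congr 1
  refine image_congr fun j hj => ?_
  exact Function.update_of_ne (ne_of_mem_erase (mem_coe.mp hj)) _ _

/-- The sequence which follows `z` before position `m` and `f` from then on. -/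
def hybrid (z f : ℕ → V) (m : ℕ) : ℕ → V := fun i => if i < m then z i else f i

/-- Two ordered edges can be turned into a common sequence by replacing their entries one at a
time from left to right, keeping an edge throughout. -/
lemma exists_common_hybrid [Fintype V] (hE : ∀ e ∈ E, e.card = k)
    (hδ : ∀ S : Finset V, S.card + 1 = k → (∃ e ∈ E, S ⊆ e) →
      Fintype.card V < 2 * (E.filter fun e => S ⊆ e).card)
    {f g : ℕ → V} (hf : (range k).image f ∈ E) (hg : (range k).image g ∈ E)
    {m : ℕ} (hm : m ≤ k) :
    ∃ z : ℕ → V, ∀ j ≤ m, (range k).image (hybrid z f j) ∈ E ∧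
      (range k).image (hybrid z g j) ∈ E := by
  induction m with
  | zero =>
    refine ⟨f, fun j hj => ?_⟩
    obtain rfl : j = 0 := by omega
    simpa [hybrid] using ⟨hf, hg⟩
  | succ m ih =>
    obtain ⟨z, hz⟩ := ih (by omega)
    have hcard : ∀ h : ℕ → V, (range k).image h ∈ E →
        (((range k).erase m).image h).card + 1 = k := by
      intro h hh
      have hinj : Set.InjOn h (range k) := card_image_iff.mp (by rw [hE _ hh, card_range])
      rw [card_image_of_injOn (hinj.mono (coe_subset.mpr (erase_subset _ _))),
        card_erase_of_mem (mem_range.mpr hm), card_range]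
      omega
    have hdeg : ∀ h : ℕ → V, (range k).image h ∈ E → Fintype.card V <
        2 * (E.filter fun e => ((range k).erase m).image h ⊆ e).card := fun h hh =>
      hδ _ (hcard h hh) ⟨_, hh, image_subset_image (erase_subset _ _)⟩
    obtain ⟨hzf, hzg⟩ := hz m le_rfl
    obtain ⟨x, hxf, hxg⟩ := exists_common_extension hE (hcard _ hzf) (hcard _ hzg)
      (hdeg _ hzf) (hdeg _ hzg)
    have hstep : ∀ h : ℕ → V, hybrid (Function.update z m x) h (m + 1) =
        Function.update (hybrid z h m) m x := by
      intro h
      funext i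
      simp only [hybrid, Function.update_apply]
      split_ifs <;> first | rfl | omega
    have hold : ∀ h : ℕ → V, ∀ j ≤ m,
        hybrid (Function.update z m x) h j = hybrid z h j := by
      intro h j hj
      funext i
      simp only [hybrid, Function.update_apply]
      split_ifs <;> first | rfl | omega
    refine ⟨Function.update z m x, fun j hj => ?_⟩
    rcases Nat.lt_or_ge m j with hlt | hle
    · obtain rfl : j = m + 1 := by omega
      rw [hstep, hstep, image_update_range _ hm, image_update_range _ hm]
      exact ⟨hxf, hxg⟩
    · rw [hold f j hle, hold g j hle]
      exact hz j hle

/-- Writing ordered edges one after the other, where consecutive ones differ in at most one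
position, yields a tight walk. -/
lemma image_window_mem (hk : 0 < k) {N : ℕ} {F : ℕ → ℕ → V}
    (hF : ∀ q ≤ N, (range k).image (F q) ∈ E)
    (hstep : ∀ q < N, ∃ d, ∀ i < k, i ≠ d → F q i = F (q + 1) i)
    {i : ℕ} (hi : i + k ≤ (N + 1) * k) :
    (range k).image (fun j => F ((i + j) / k) ((i + j) % k)) ∈ E := by
  have hwindow : ∀ G : ℕ → V,
      (∀ j < k, F ((i + j) / k) ((i + j) % k) = G ((i + j) % k)) →
      (range k).image (fun j => F ((i + j) / k) ((i + j) % k)) = (range k).image G := by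
    intro G hG
    rw [image_congr (g := fun j => G ((i + j) % k)) fun j hj => hG j (by simpa using hj)]
    conv_rhs => rw [← Nat.image_Ico_mod i k, image_image]
    ext y
    simp only [mem_image, mem_range, mem_Ico, Function.comp_apply]
    constructor
    · rintro ⟨j, hj, rfl⟩
      exact ⟨i + j, by omega, rfl⟩
    · rintro ⟨j, hj, rfl⟩
      exact ⟨j - i, by omega, by rw [Nat.add_sub_cancel' hj.1]⟩
  obtain ⟨q, p, hp, rfl⟩ : ∃ q p, p < k ∧ i = k * q + p :=
    ⟨i / k, i % k, Nat.mod_lt _ hk, (Nat.div_add_mod i k).symm⟩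
  have hsmall : ∀ j, p + j < k →
      (k * q + p + j) / k = q ∧ (k * q + p + j) % k = p + j := by
    intro j hj
    rw [add_assoc, Nat.mul_add_div hk, Nat.div_eq_of_lt hj, Nat.mul_add_mod,
      Nat.mod_eq_of_lt hj]
    exact ⟨rfl, rfl⟩
  have hlarge : ∀ j < k, k ≤ p + j →
      (k * q + p + j) / k = q + 1 ∧ (k * q + p + j) % k = p + j - k := by
    intro j hj hkj
    have hsplit : k * q + p + j = k * (q + 1) + (p + j - k) := by rw [mul_add]; omega
    have hlt : p + j - k < k := by omega
    rw [hsplit, Nat.mul_add_div hk, Nat.div_eq_of_lt hlt, Nat.mul_add_mod,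
      Nat.mod_eq_of_lt hlt]
    exact ⟨rfl, rfl⟩
  have hqN : q ≤ N := by
    by_contra! hlt
    have := Nat.mul_le_mul_left k (show N + 1 ≤ q from hlt)
    rw [mul_comm _ k] at hi
    omega
  rcases Nat.eq_zero_or_pos p with rfl | hp0
  · rw [hwindow (F q) fun j hj => by rw [(hsmall j (by omega)).1]]
    exact hF q hqN
  have hqN' : q < N := by
    refine lt_of_le_of_ne hqN ?_
    rintro rfl
    rw [mul_comm _ k, mul_add] at hi
    omega
  obtain ⟨d, hd⟩ := hstep q hqN'
  rcases Nat.lt_or_ge d p with hdp | hpd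
  · rw [hwindow (F (q + 1))]
    · exact hF _ hqN'
    intro j hj
    rcases Nat.lt_or_ge (p + j) k with h | h
    · rw [(hsmall j h).1, (hsmall j h).2]
      exact hd _ (by omega) (by omega)
    · rw [(hlarge j hj h).1]
  · rw [hwindow (F q)]
    · exact hF _ hqN
    intro j hj
    rcases Nat.lt_or_ge (p + j) k with h | h
    · rw [(hsmall j h).1]
    · rw [(hlarge j hj h).1, (hlarge j hj h).2]
      exact (hd _ (by omega) (by omega)).symm

/-- An ordered set contained in an edge extends to an ordering of that edge in which its
entries occupy prescribed positions. -/
lemma exists_ordered_edge {e : Finset V} (he : e.card = k) {s : ℕ} {u : Fin s → V}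
    (hu : Function.Injective u) (hue : univ.image u ⊆ e) {c : ℕ} (hc : c + s ≤ k) (hs : 1 ≤ s) :
    ∃ f : ℕ → V, (range k).image f = e ∧ ∀ j : Fin s, f (c + j) = u j := by
  have hpos : ∀ j : Fin s, c + (j : ℕ) < k := fun j => by omega
  let p : Fin s → Fin k := fun j => ⟨c + j, hpos j⟩
  have hp : Function.Injective p := fun a b hab => by
    simpa [p, Fin.ext_iff] using hab
  let f₀ : Fin k → V := Function.extend p u fun _ => u ⟨0, hs⟩
  have hf₀ : ∀ j, f₀ (p j) = u j := fun j => hp.extend_apply _ _ _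
  obtain ⟨g, hg⟩ := Finset.exists_equiv_extend_of_card_eq (t := e) (s := univ.image p) (f := f₀)
    (by rw [Fintype.card_fin, he])
    (by
      rw [image_image]
      exact (image_congr fun j _ => hf₀ j).trans_subset hue)
    (by
      intro a ha b hb hab
      simp only [coe_image, coe_univ, Set.image_univ, Set.mem_range] at ha hb
      obtain ⟨a, rfl⟩ := ha
      obtain ⟨b, rfl⟩ := hb
      rw [hf₀, hf₀] at hab
      rw [hu hab])
  refine ⟨fun i => if h : i < k then g ⟨i, h⟩ else u ⟨0, hs⟩, ?_, fun j => ?_⟩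
  · ext x
    simp only [mem_image, mem_range]
    constructor
    · rintro ⟨i, hi, rfl⟩
      rw [dif_pos hi]
      exact (g ⟨i, hi⟩).2
    · intro hx
      refine ⟨g.symm ⟨x, hx⟩, (g.symm ⟨x, hx⟩).2, ?_⟩
      rw [dif_pos (g.symm ⟨x, hx⟩).2, Fin.eta, Equiv.apply_symm_apply]
  · simp only [dif_pos (hpos j)]
    exact (hg (p j) (mem_image_of_mem p (mem_univ j))).trans (hf₀ j)

end TightWalk

/-- In a `k`-graph with `δ* > n/2`, no isolated vertices and `n ≥ 4k`, any two
ordered supported sets `S = u_1…u_s` and `T = v_1…v_{t'}` (with `s, t' ∈ [k]`)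
are joined by a tight walk starting with `S`, ending with `T`, and having at
least `k` vertices strictly between them. -/
theorem tight_walk_joining_ordered_supported_sets
    (k n : ℕ) (hk : 3 ≤ k) (hn : 4 * k ≤ n)
    (E : Finset (Finset (Fin n))) (hE : ∀ e ∈ E, e.card = k)
    (hiso : ∀ v : Fin n, ∃ e ∈ E, v ∈ e)
    (hδ : ∀ S : Finset (Fin n), S.card = k - 1 → (∃ e ∈ E, S ⊆ e) →
      (n : ℝ) / 2 < ((E.filter fun e => S ⊆ e).card : ℝ))
    (s t' : ℕ) (hs1 : 1 ≤ s) (hsk : s ≤ k) (ht1 : 1 ≤ t') (htk : t' ≤ k)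
    (u : Fin s → Fin n) (hu : Function.Injective u)
    (husupp : ∃ e ∈ E, Finset.image u Finset.univ ⊆ e)
    (v : Fin t' → Fin n) (hv : Function.Injective v)
    (hvsupp : ∃ e ∈ E, Finset.image v Finset.univ ⊆ e) :
    ∃ r : ℕ, ∃ w : ℕ → Fin n,
      s + t' + k ≤ r ∧
      (∀ i : ℕ, i + k ≤ r →
        (Finset.image (fun j : Fin k => w (i + (j : ℕ))) Finset.univ) ∈ E) ∧
      (∀ j : Fin s, w (j : ℕ) = u j) ∧
      (∀ j : Fin t', w (r - t' + (j : ℕ)) = v j) := by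
  have hk0 : 0 < k := by omega
  obtain ⟨e, he, hue⟩ := husupp
  obtain ⟨e', he', hve⟩ := hvsupp
  obtain ⟨f, hfe, hfu⟩ := exists_ordered_edge (hE e he) hu hue (c := 0) (by omega) hs1
  obtain ⟨g, hge, hgv⟩ := exists_ordered_edge (hE e' he') hv hve (c := k - t') (by omega) ht1
  have hδ' : ∀ S : Finset (Fin n), S.card + 1 = k → (∃ e ∈ E, S ⊆ e) →
      Fintype.card (Fin n) < 2 * (E.filter fun e => S ⊆ e).card := by
    intro S hS hsupp
    have h := hδ S (by omega) hsupp
    rw [Fintype.card_fin]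
    have h2 : (n : ℝ) < 2 * ((E.filter fun e => S ⊆ e).card : ℝ) := by linarith
    exact_mod_cast h2
  obtain ⟨z, hz⟩ := exists_common_hybrid hE hδ' (hfe ▸ he) (hge ▸ he') le_rfl
  let F : ℕ → ℕ → Fin n := fun q =>
    if q ≤ k then hybrid z f q else hybrid z g (2 * k + 1 - q)
  have hF : ∀ q ≤ 2 * k + 1, (range k).image (F q) ∈ E := by
    intro q hq
    by_cases hqk : q ≤ k
    · simpa only [F, if_pos hqk] using (hz q hqk).1
    · simpa only [F, if_neg hqk] using (hz (2 * k + 1 - q) (by omega)).2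
  have hstep : ∀ q < 2 * k + 1, ∃ d, ∀ i < k, i ≠ d → F q i = F (q + 1) i := by
    intro q hq
    refine ⟨if q < k then q else 2 * k - q, fun i hi hid => ?_⟩
    simp only [F]
    split_ifs at hid ⊢ <;> simp only [hybrid] <;> split_ifs <;> first | rfl | omega
  refine ⟨(2 * k + 1 + 1) * k, fun m => F (m / k) (m % k), ?_,
    fun i hi => ?_, fun j => ?_, fun j => ?_⟩
  · nlinarith
  · convert image_window_mem hk0 hF hstep hi using 1
    ext x
    simp [Fin.exists_iff]
  · have hj : (j : ℕ) < k := by omega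
    simpa [Nat.div_eq_of_lt hj, Nat.mod_eq_of_lt hj, F, hybrid] using hfu j
  · have hlt : k - t' + (j : ℕ) < k := by omega
    have hidx : (2 * k + 1 + 1) * k - t' + (j : ℕ) = k * (2 * k + 1) + (k - t' + j) := by
      rw [add_mul _ 1, one_mul, mul_comm _ k]
      omega
    simp only [hidx, Nat.mul_add_div hk0, Nat.div_eq_of_lt hlt, Nat.mul_add_mod,
      Nat.mod_eq_of_lt hlt]
    simpa [F, hybrid, show ¬ 2 * k + 1 ≤ k by omega] using hgv j
end

section
/- Let k ≥ 3, ℓ ∈ [k−1], and let G be an n-vertex k-graph with δ*(G) > n/2, no isolated vertices, and n ≥ 4k. Let S and T be ordered supported sets of sizes s, t' ∈ [k] respectively. Then for any q ∈ {0, 1, …, k−ℓ−1}, there exists a tight walk in G whose first s vertices are S in order and whose last t' vertices are T in order, whose order is at least 2k and congruent to q modulo k−ℓ. -/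
open Finset

namespace TightWalk

variable {V : Type*} [DecidableEq V]

/-- Any two supported `(k-1)`-sets can be completed to edges by a common vertex. -/
def CommonExtension (k : ℕ) (E : Finset (Finset V)) : Prop :=
  ∀ B C : Finset V, B.card = k - 1 → C.card = k - 1 → (∃ e ∈ E, B ⊆ e) → (∃ e ∈ E, C ⊆ e) →
    ∃ x, x ∉ B ∧ x ∉ C ∧ insert x B ∈ E ∧ insert x C ∈ E

/-- There is a tight walk of order `N + k` whose first `k` vertices are `p 0, …, p (k-1)` and whose
last `k` vertices are `p' 0, …, p' (k-1)`. -/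
def Reach (k : ℕ) (E : Finset (Finset V)) (N : ℕ) (p p' : ℕ → V) : Prop :=
  ∃ w : ℕ → V, (∀ i ≤ N, (range k).image (fun j => w (i + j)) ∈ E) ∧
    (∀ j < k, w j = p j) ∧ ∀ j < k, w (N + j) = p' j

/-- Two ordered edges are joined by a tight walk whose order is a multiple of `k`. -/
def ReachMul (k : ℕ) (E : Finset (Finset V)) (p p' : ℕ → V) : Prop :=
  ∃ m, Reach k E (m * k) p p'

variable {k : ℕ} {E : Finset (Finset V)}

theorem image_congr_range {p p' : ℕ → V} (h : ∀ j < k, p j = p' j) :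
    (range k).image p = (range k).image p' :=
  image_congr fun j hj => h j (by simpa using hj)

theorem injOn_of_image_mem (hE : ∀ e ∈ E, e.card = k) {p : ℕ → V}
    (hp : (range k).image p ∈ E) : Set.InjOn p (range k) :=
  card_image_iff.mp (by simpa using hE _ hp)

theorem Reach.trans {M N : ℕ} {p p' p'' : ℕ → V} (h : Reach k E M p p')
    (h' : Reach k E N p' p'') : Reach k E (M + N) p p'' := by
  obtain ⟨w, hw, hp, hp'⟩ := h
  obtain ⟨w', hw', hq, hq'⟩ := h'
  have hle : ∀ i < M + k, (if i < M then w i else w' (i - M)) = w i := by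
    intro i hi
    split_ifs with h
    · rfl
    · rw [hq _ (by omega), ← hp' _ (by omega), Nat.add_sub_cancel' (by omega)]
  have hge : ∀ i, (if M + i < M then w (M + i) else w' (M + i - M)) = w' i := by
    intro i
    rw [if_neg (by omega), Nat.add_sub_cancel_left]
  refine ⟨fun i => if i < M then w i else w' (i - M), ?_, ?_, ?_⟩
  · intro i hi
    rcases le_or_gt i M with h | h
    · rw [image_congr_range (p' := fun j => w (i + j)) fun j hj => hle _ (by omega)]
      exact hw i h
    · obtain ⟨c, rfl⟩ := Nat.exists_eq_add_of_lt h
      rw [image_congr_range (p' := fun j => w' (c + 1 + j)) fun j hj => by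
        rw [← hge (c + 1 + j), show M + c + 1 + j = M + (c + 1 + j) by omega]]
      exact hw' _ (by omega)
  · exact fun j hj => (hle j (by omega)).trans (hp j hj)
  · exact fun j hj => by
      rw [← hq' j hj, ← hge (N + j), show M + N + j = M + (N + j) by omega]

theorem Reach.refl {p : ℕ → V} (hp : (range k).image p ∈ E) : Reach k E 0 p p :=
  ⟨p, fun i hi => by
    obtain rfl : i = 0 := by omega
    simpa using hp, fun _ _ => rfl, fun j _ => by simp⟩

theorem Reach.congr_right {N : ℕ} {p p' p'' : ℕ → V} (h : Reach k E N p p')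
    (hp : ∀ j < k, p' j = p'' j) : Reach k E N p p'' := by
  obtain ⟨w, hw, h1, h2⟩ := h
  exact ⟨w, hw, h1, fun j hj => (h2 j hj).trans (hp j hj)⟩

theorem Reach.iterate {N : ℕ} {p : ℕ → V} (hp : (range k).image p ∈ E) (h : Reach k E N p p)
    (a : ℕ) : Reach k E (a * N) p p := by
  induction a with
  | zero => simpa using Reach.refl hp
  | succ a ih => simpa [Nat.succ_mul] using ih.trans h

theorem ReachMul.trans {p p' p'' : ℕ → V} (h : ReachMul k E p p') (h' : ReachMul k E p' p'') :
    ReachMul k E p p'' := by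
  obtain ⟨m, h⟩ := h
  obtain ⟨m', h'⟩ := h'
  exact ⟨m + m', by simpa [Nat.add_mul] using h.trans h'⟩

theorem ReachMul.refl {p : ℕ → V} (hp : (range k).image p ∈ E) : ReachMul k E p p :=
  ⟨0, by simpa using Reach.refl hp⟩

/-- Changing one entry of an ordered edge in place. -/
theorem reach_of_eq_off_index {p p' : ℕ → V} (hp : (range k).image p ∈ E)
    (hp' : (range k).image p' ∈ E) (i : ℕ) (h : ∀ j < k, j ≠ i → p j = p' j) :
    Reach k E k p p' := by
  refine ⟨fun j => if j < k then p j else p' (j - k), ?_, ?_, ?_⟩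
  · intro c hc
    suffices hs : ∀ r : ℕ → V, (∀ j < k, c ≤ j → p j = r j) → (∀ j < c, p' j = r j) →
        (range k).image (fun j => if c + j < k then p (c + j) else p' (c + j - k)) =
          (range k).image r by
      rcases le_or_gt c i with hi | hi
      · rw [hs p (fun _ _ _ => rfl) fun j hj => (h j (by omega) (by omega)).symm]
        exact hp
      · rw [hs p' (fun j hj hcj => h j hj (by omega)) fun _ _ => rfl]
        exact hp'
    intro r h1 h2
    ext y
    simp only [mem_image, mem_range]
    constructor
    · rintro ⟨j, hj, rfl⟩
      split_ifs with hcj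
      · exact ⟨c + j, hcj, (h1 _ hcj (by omega)).symm⟩
      · exact ⟨c + j - k, by omega, (h2 _ (by omega)).symm⟩
    · rintro ⟨j, hj, rfl⟩
      rcases le_or_gt c j with hcj | hcj
      · refine ⟨j - c, by omega, ?_⟩
        rw [Nat.add_sub_cancel' hcj, if_pos hj, h1 j hj hcj]
      · refine ⟨k + j - c, by omega, ?_⟩
        rw [Nat.add_sub_cancel' (by omega), if_neg (by omega), Nat.add_sub_cancel_left, h2 j hcj]
  · exact fun j hj => if_pos hj
  · exact fun j hj => by simp

theorem reachMul_of_eq_off_index {p p' : ℕ → V} (hp : (range k).image p ∈ E)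
    (hp' : (range k).image p' ∈ E) (i : ℕ) (h : ∀ j < k, j ≠ i → p j = p' j) :
    ReachMul k E p p' :=
  ⟨1, by simpa using reach_of_eq_off_index hp hp' i h⟩

theorem image_update {p : ℕ → V} (hinj : Set.InjOn p (range k)) {i : ℕ} (hi : i < k) (x : V) :
    (range k).image (Function.update p i x) = insert x (((range k).image p).erase (p i)) := by
  ext y
  simp only [mem_image, mem_range, mem_insert, mem_erase]
  constructor
  · rintro ⟨j, hj, rfl⟩
    by_cases hji : j = i
    · simp [hji]
    · right
      rw [Function.update_of_ne hji]
      exact ⟨fun h => hji (hinj (by simpa using hj) (by simpa using hi) h), j, hj, rfl⟩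
  · rintro (rfl | ⟨hne, j, hj, rfl⟩)
    · exact ⟨i, hi, by simp⟩
    · exact ⟨j, hj, Function.update_of_ne (by rintro rfl; exact hne rfl) _ _⟩

theorem image_comp_swap (p : ℕ → V) {i j : ℕ} (hi : i < k) (hj : j < k) :
    (range k).image (p ∘ Equiv.swap i j) = (range k).image p := by
  have hlt : ∀ a < k, Equiv.swap i j a < k := by
    intro a ha
    rw [Equiv.swap_apply_def]
    split_ifs <;> assumption
  ext y
  simp only [mem_image, mem_range, Function.comp_apply]
  constructor
  · rintro ⟨a, ha, rfl⟩
    exact ⟨_, hlt a ha, rfl⟩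
  · rintro ⟨a, ha, rfl⟩
    exact ⟨_, hlt a ha, by simp⟩

theorem reachMul_swap (hE : ∀ e ∈ E, e.card = k) (hc : CommonExtension k E) {p : ℕ → V}
    (hp : (range k).image p ∈ E) {i j : ℕ} (hi : i < k) (hj : j < k) :
    ReachMul k E p (p ∘ Equiv.swap i j) := by
  rcases eq_or_ne i j with rfl | hij
  · simpa using ReachMul.refl hp
  have hinj := injOn_of_image_mem hE hp
  have hmem : ∀ a < k, p a ∈ (range k).image p := fun a ha =>
    mem_image_of_mem _ (by simpa using ha)
  obtain ⟨x, -, -, hxi, hxj⟩ := hc (((range k).image p).erase (p i))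
    (((range k).image p).erase (p j))
    (by rw [card_erase_of_mem (hmem i hi), hE _ hp])
    (by rw [card_erase_of_mem (hmem j hj), hE _ hp])
    ⟨_, hp, erase_subset _ _⟩ ⟨_, hp, erase_subset _ _⟩
  have hswap : (range k).image (p ∘ Equiv.swap i j) ∈ E := by rwa [image_comp_swap p hi hj]
  have h1 : (range k).image (Function.update p i x) ∈ E := by rwa [image_update hinj hi]
  have h2 : (range k).image (Function.update (p ∘ Equiv.swap i j) i x) ∈ E := by
    rw [image_update (injOn_of_image_mem hE hswap) hi, image_comp_swap p hi hj]
    simpa using hxj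
  refine (reachMul_of_eq_off_index hp h1 i ?_).trans
    ((reachMul_of_eq_off_index h1 h2 j ?_).trans (reachMul_of_eq_off_index h2 hswap i ?_))
  · exact fun a _ ha => (Function.update_of_ne ha _ _).symm
  · intro a _ ha
    by_cases hai : a = i
    · simp [hai]
    · simp [Function.update_of_ne hai, Equiv.swap_apply_of_ne_of_ne hai ha]
  · exact fun a _ ha => Function.update_of_ne ha _ _

theorem reachMul_of_image_eq (hE : ∀ e ∈ E, e.card = k) (hc : CommonExtension k E) {p p' : ℕ → V}
    (hp : (range k).image p ∈ E) (hpp' : (range k).image p = (range k).image p') :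
    ReachMul k E p p' := by
  have hinj' := injOn_of_image_mem hE (hpp' ▸ hp)
  have key : ∀ m ≤ k, ∃ r : ℕ → V, (range k).image r = (range k).image p' ∧
      ReachMul k E p r ∧ ∀ j < m, r j = p' j := by
    intro m
    induction m with
    | zero => exact fun _ => ⟨p, hpp', .refl hp, by simp⟩
    | succ m ih =>
      intro hm
      obtain ⟨r, hr, hpr, hag⟩ := ih (by omega)
      have hmem : p' m ∈ (range k).image r := by
        rw [hr]
        exact mem_image_of_mem _ (by simpa using hm)
      obtain ⟨i, hi, him⟩ := mem_image.mp hmem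
      have hik : i < k := by simpa using hi
      have hmi : m ≤ i := by
        by_contra! h
        rw [hag i h] at him
        exact h.ne (hinj' (by simpa using hik) (by simpa using hm) him)
      refine ⟨r ∘ Equiv.swap m i, by rw [image_comp_swap r hm hik, hr],
        hpr.trans (reachMul_swap hE hc (by rwa [hr, ← hpp']) hm hik), ?_⟩
      intro j hj
      rcases Nat.lt_succ_iff_lt_or_eq.mp hj with hj | rfl
      · rw [Function.comp_apply, Equiv.swap_apply_of_ne_of_ne (by omega) (by omega), hag j hj]
      · simpa using him
  obtain ⟨r, -, ⟨m, hr⟩, hag⟩ := key k le_rfl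
  exact ⟨m, hr.congr_right hag⟩

/-- Any ordering of the edge `e` can be transformed into some ordering of the edge `f`. -/
def EdgeConn (k : ℕ) (E : Finset (Finset V)) (e f : Finset V) : Prop :=
  ∀ p : ℕ → V, (range k).image p = e → ∃ p' : ℕ → V, (range k).image p' = f ∧ ReachMul k E p p'

theorem EdgeConn.trans {e f g : Finset V} (h : EdgeConn k E e f) (h' : EdgeConn k E f g) :
    EdgeConn k E e g := by
  intro p hp
  obtain ⟨p', hp', h1⟩ := h p hp
  obtain ⟨p'', hp'', h2⟩ := h' p' hp'
  exact ⟨p'', hp'', h1.trans h2⟩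

theorem edgeConn_insert (hE : ∀ e ∈ E, e.card = k) {B : Finset V} {x y : V} (hx : x ∉ B)
    (hxB : insert x B ∈ E) (hyB : insert y B ∈ E) :
    EdgeConn k E (insert x B) (insert y B) := by
  intro p hp
  have hpE : (range k).image p ∈ E := by rwa [hp]
  obtain ⟨i, hi, rfl⟩ : ∃ i ∈ range k, p i = x := by
    rw [← mem_image, hp]
    exact mem_insert_self _ _
  have himg : (range k).image (Function.update p i y) = insert y B := by
    rw [image_update (injOn_of_image_mem hE hpE) (by simpa using hi), hp, erase_insert hx]
  exact ⟨_, himg, reachMul_of_eq_off_index hpE (by rwa [himg]) i fun j _ hj =>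
    (Function.update_of_ne hj _ _).symm⟩

theorem edgeConn_of_subset (hE : ∀ e ∈ E, e.card = k) (hc : CommonExtension k E) (d : ℕ) :
    ∀ A e f : Finset V, A.card + 1 + d = k → e ∈ E → f ∈ E → A ⊆ e → A ⊆ f →
      EdgeConn k E e f := by
  induction d with
  | zero =>
    intro A e f hA he hf hAe hAf
    obtain ⟨x, hx, rfl⟩ :=
      (exists_eq_insert_iff (s := A) (t := e)).mpr ⟨hAe, by rw [hE e he]; omega⟩
    obtain ⟨y, hy, rfl⟩ :=
      (exists_eq_insert_iff (s := A) (t := f)).mpr ⟨hAf, by rw [hE f hf]; omega⟩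
    exact edgeConn_insert hE hx he hf
  | succ d ih =>
    have extend : ∀ A e : Finset V, A.card + 1 + (d + 1) = k → e ∈ E → A ⊆ e →
        ∃ a, a ∉ A ∧ a ∈ e ∧ ∃ B : Finset V, insert a A ⊆ B ∧ B ⊆ e ∧ B.card = k - 1 := by
      intro A e hA he hAe
      obtain ⟨a, hae, haA⟩ := exists_mem_notMem_of_card_lt_card
        (show A.card < e.card by rw [hE e he]; omega)
      obtain ⟨B, hB⟩ := exists_subsuperset_card_eq (insert_subset hae hAe)
        (show (insert a A).card ≤ k - 1 by rw [card_insert_of_notMem haA]; omega)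
        (by rw [hE e he]; omega)
      exact ⟨a, haA, hae, B, hB⟩
    intro A e f hA he hf hAe hAf
    obtain ⟨a, haA, hae, B, hAB, hBe, hB⟩ := extend A e hA he hAe
    obtain ⟨c, hcA, hcf, C, hAC, hCf, hC⟩ := extend A f hA hf hAf
    obtain ⟨x, hxB, hxC, hxBE, hxCE⟩ := hc B C hB hC ⟨e, he, hBe⟩ ⟨f, hf, hCf⟩
    have hAB' := (subset_insert a A).trans hAB
    have hAC' := (subset_insert c A).trans hAC
    have hcard : ∀ y ∉ A, (insert y A).card + 1 + d = k := by
      intro y hy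
      rw [card_insert_of_notMem hy]
      omega
    refine (ih (insert a A) e (insert x B) (hcard a haA) he hxBE (insert_subset hae hAe)
      (hAB.trans (subset_insert _ _))).trans
      ((ih (insert x A) _ (insert x C) (hcard x fun h => hxB (hAB' h)) hxBE hxCE
        (insert_subset_insert _ hAB') (insert_subset_insert _ hAC')).trans
      (ih (insert c A) _ f (hcard c hcA) hxCE hf (hAC.trans (subset_insert _ _))
        (insert_subset hcf hAf)))

theorem reachMul_of_mem (hk : 1 ≤ k) (hE : ∀ e ∈ E, e.card = k) (hc : CommonExtension k E)
    {p p' : ℕ → V} (hp : (range k).image p ∈ E) (hp' : (range k).image p' ∈ E) :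
    ReachMul k E p p' := by
  obtain ⟨r, hr, hpr⟩ := edgeConn_of_subset hE hc (k - 1) ∅ _ _ (by simp; omega) hp hp'
    (empty_subset _) (empty_subset _) p rfl
  exact hpr.trans (reachMul_of_image_eq hE hc (by rwa [hr]) hr)

theorem reach_rotate (hk : 1 ≤ k) {p : ℕ → V} (hp : (range k).image p ∈ E) :
    (range k).image (fun j => p ((1 + j) % k)) ∈ E ∧
      Reach k E 1 p (fun j => p ((1 + j) % k)) := by
  have himg : (range k).image (fun j => p ((1 + j) % k)) = (range k).image p := by
    ext y
    simp only [mem_image, mem_range]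
    constructor
    · rintro ⟨j, hj, rfl⟩
      exact ⟨_, Nat.mod_lt _ hk, rfl⟩
    · rintro ⟨j, hj, rfl⟩
      rcases Nat.eq_zero_or_pos j with rfl | h
      · exact ⟨k - 1, by omega, by rw [Nat.add_sub_cancel' hk, Nat.mod_self]⟩
      · exact ⟨j - 1, by omega, by rw [Nat.add_sub_cancel' h, Nat.mod_eq_of_lt hj]⟩
  refine ⟨by rwa [himg], fun j => p (j % k), ?_, fun j hj => by simp [Nat.mod_eq_of_lt hj],
    fun _ _ => rfl⟩
  intro i hi
  obtain rfl | rfl : i = 0 ∨ i = 1 := by omega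
  · rwa [image_congr_range (p' := p) fun j hj => by simp [Nat.mod_eq_of_lt hj]]
  · rwa [himg]

/-- Walks between two given ordered edges exist in every residue class. -/
theorem exists_reach_modEq (hk : 1 ≤ k) (hE : ∀ e ∈ E, e.card = k) (hc : CommonExtension k E)
    {p p' : ℕ → V} (hp : (range k).image p ∈ E) (hp' : (range k).image p' ∈ E)
    {d : ℕ} (hd : 1 ≤ d) (q : ℕ) :
    ∃ N, k ≤ N ∧ (N + k) ≡ q [MOD d] ∧ Reach k E N p p' := by
  obtain ⟨m₀, h₀⟩ := reachMul_of_mem hk hE hc hp hp'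
  obtain ⟨hrot, h1⟩ := reach_rotate hk hp
  obtain ⟨m, hm⟩ := reachMul_of_mem hk hE hc hrot hp
  have hkk : Reach k E k p p := reach_of_eq_off_index hp hp 0 fun _ _ _ => rfl
  obtain ⟨d, rfl⟩ := Nat.exists_eq_add_of_le' hd
  have hcl : Reach k E (1 + m * k * (d + 1)) p p := by
    convert (h1.trans hm).trans (hkk.iterate hp (m * d)) using 1
    ring
  refine ⟨_, ?_, ?_, (hcl.iterate hp (q + (m₀ + 1) * k * d + (d + 1) * k)).trans h₀⟩
  · nlinarith [Nat.zero_le (m * k * (d + 1)), Nat.zero_le ((m₀ + 1) * k * d), Nat.zero_le (d * k),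
      Nat.zero_le ((q + (m₀ + 1) * k * d + (d + 1) * k) * (m * k * (d + 1))),
      Nat.zero_le (m₀ * k)]
  · have : (q + (m₀ + 1) * k * d + (d + 1) * k) * (1 + m * k * (d + 1)) + m₀ * k + k =
        q + (d + 1) * ((m₀ + 1) * k + k +
          (q + (m₀ + 1) * k * d + (d + 1) * k) * (m * k)) := by ring
    rw [this]
    simp [Nat.ModEq]

theorem exists_ordering_extending {e : Finset V} (he : e.card = k) (hk : 1 ≤ k)
    {I : Finset (Fin k)} {f : Fin k → V} (hf : I.image f ⊆ e) (hinj : Set.InjOn f I) :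
    ∃ p : ℕ → V, (range k).image p = e ∧ ∀ i ∈ I, p i = f i := by
  obtain ⟨g, hg⟩ := exists_equiv_extend_of_card_eq (by simpa using he.symm) hf hinj
  refine ⟨fun j => if h : j < k then g ⟨j, h⟩ else g ⟨0, hk⟩, ?_, fun i hi => by simp [hg i hi]⟩
  ext y
  simp only [mem_image, mem_range]
  constructor
  · rintro ⟨j, hj, rfl⟩
    simp [hj]
  · intro hy
    exact ⟨g.symm ⟨y, hy⟩, Fin.is_lt _, by simp⟩

/-- An ordered supported set can be placed on a block of consecutive positions of an ordered
edge. -/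
theorem exists_ordering_block (hk : 1 ≤ k) (hE : ∀ e ∈ E, e.card = k) {s a : ℕ} (hs : 1 ≤ s)
    (has : a + s ≤ k) {u : Fin s → V} (hu : Function.Injective u)
    (hsupp : ∃ e ∈ E, univ.image u ⊆ e) :
    ∃ p : ℕ → V, (range k).image p ∈ E ∧ ∀ j : Fin s, p (a + j) = u j := by
  obtain ⟨e, he, hue⟩ := hsupp
  let b : Fin s → Fin k := fun j => ⟨a + j, by omega⟩
  have hb : Function.Injective b := fun i j h => by
    simpa [b, Fin.ext_iff] using h
  have : Nonempty (Fin s) := ⟨⟨0, hs⟩⟩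
  have hub : ∀ j, (u ∘ Function.invFun b) (b j) = u j := fun j => by
    rw [Function.comp_apply, Function.leftInverse_invFun hb]
  obtain ⟨p, hp, hpu⟩ := exists_ordering_extending (I := univ.image b)
    (f := u ∘ Function.invFun b) (hE e he) hk
    (by
      intro y hy
      simp only [mem_image, mem_univ, true_and, exists_exists_eq_and, hub] at hy
      exact hue (by simpa using hy))
    (by
      intro x hx y hy hxy
      simp only [coe_image, coe_univ, Set.image_univ, Set.mem_range] at hx hy
      obtain ⟨i, rfl⟩ := hx
      obtain ⟨j, rfl⟩ := hy
      rw [hub, hub] at hxy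
      rw [hu hxy])
  exact ⟨p, hp ▸ he, fun j => (hpu (b j) (mem_image_of_mem _ (mem_univ _))).trans (hub j)⟩

theorem card_filter_superset_le [Fintype V] (hk : 1 ≤ k) (hE : ∀ e ∈ E, e.card = k)
    {B : Finset V} (hB : B.card = k - 1) :
    (E.filter fun e => B ⊆ e).card ≤ (univ.filter fun x => x ∉ B ∧ insert x B ∈ E).card := by
  refine (card_le_card ?_).trans (card_image_le (f := fun x => insert x B))
  intro e he
  obtain ⟨heE, hBe⟩ := mem_filter.mp he
  obtain ⟨x, hx, rfl⟩ :=
    (exists_eq_insert_iff (s := B) (t := e)).mpr ⟨hBe, by rw [hE e heE]; omega⟩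
  exact mem_image_of_mem _ (by simp [hx, heE])

theorem commonExtension_of_half_lt [Fintype V] (hk : 1 ≤ k) (hE : ∀ e ∈ E, e.card = k)
    (hδ : ∀ S : Finset V, S.card = k - 1 → (∃ e ∈ E, S ⊆ e) →
      Fintype.card V < 2 * (E.filter fun e => S ⊆ e).card) : CommonExtension k E := by
  intro B C hB hC hBs hCs
  have h1 := hδ B hB hBs
  have h2 := hδ C hC hCs
  have h3 := card_filter_superset_le hk hE hB
  have h4 := card_filter_superset_le hk hE hC
  obtain ⟨x, hx⟩ := inter_nonempty_of_card_lt_card_add_card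
    (subset_univ (univ.filter fun x => x ∉ B ∧ insert x B ∈ E))
    (subset_univ (univ.filter fun x => x ∉ C ∧ insert x C ∈ E))
    (by rw [card_univ]; omega)
  simp only [mem_inter, mem_filter, mem_univ, true_and] at hx
  exact ⟨x, hx.1.1, hx.2.1, hx.1.2, hx.2.2⟩

end TightWalk

/-- In a `k`-graph with `δ* > n/2`, no isolated vertices and `n ≥ 4k`, any two
ordered supported sets `S`, `T` (of sizes `s, t' ∈ [k]`) are joined by a tight
walk starting with `S` and ending with `T`, whose order is at least `2k` and
congruent to `q` modulo `k - ℓ`, for any prescribed `q ∈ {0, …, k-ℓ-1}`. -/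
theorem tight_walk_prescribed_order_mod
    (k l n : ℕ) (hk : 3 ≤ k) (hl : 1 ≤ l) (hlk : l ≤ k - 1) (hn : 4 * k ≤ n)
    (E : Finset (Finset (Fin n))) (hE : ∀ e ∈ E, e.card = k)
    (hiso : ∀ v : Fin n, ∃ e ∈ E, v ∈ e)
    (hδ : ∀ S : Finset (Fin n), S.card = k - 1 → (∃ e ∈ E, S ⊆ e) →
      (n : ℝ) / 2 < ((E.filter fun e => S ⊆ e).card : ℝ))
    (s t' : ℕ) (hs1 : 1 ≤ s) (hsk : s ≤ k) (ht1 : 1 ≤ t') (htk : t' ≤ k)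
    (u : Fin s → Fin n) (hu : Function.Injective u)
    (husupp : ∃ e ∈ E, Finset.image u Finset.univ ⊆ e)
    (v : Fin t' → Fin n) (hv : Function.Injective v)
    (hvsupp : ∃ e ∈ E, Finset.image v Finset.univ ⊆ e)
    (q : ℕ) (hq : q < k - l) :
    ∃ r : ℕ, ∃ w : ℕ → Fin n,
      2 * k ≤ r ∧ r % (k - l) = q ∧
      (∀ i : ℕ, i + k ≤ r →
        (Finset.image (fun j : Fin k => w (i + (j : ℕ))) Finset.univ) ∈ E) ∧
      (∀ j : Fin s, w (j : ℕ) = u j) ∧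
      (∀ j : Fin t', w (r - t' + (j : ℕ)) = v j) := by
  have hk1 : 1 ≤ k := by omega
  have hc : TightWalk.CommonExtension k E := by
    refine TightWalk.commonExtension_of_half_lt hk1 hE fun S hS hSs => ?_
    have h := hδ S hS hSs
    rw [Fintype.card_fin]
    have h' : (n : ℝ) < 2 * ((E.filter fun e => S ⊆ e).card : ℝ) := by linarith
    exact_mod_cast h'
  obtain ⟨p, hp, hpu⟩ :=
    TightWalk.exists_ordering_block (a := 0) hk1 hE hs1 (by omega) hu husupp
  obtain ⟨p', hp', hpv⟩ :=
    TightWalk.exists_ordering_block (a := k - t') hk1 hE ht1 (by omega) hv hvsupp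
  obtain ⟨N, hN, hmod, w, hw, hwp, hwp'⟩ :=
    TightWalk.exists_reach_modEq hk1 hE hc hp hp' (show 1 ≤ k - l by omega) q
  refine ⟨N + k, w, by omega, Eq.trans hmod (Nat.mod_eq_of_lt hq), fun i hi => ?_, fun j => ?_,
    fun j => ?_⟩
  · convert hw i (by omega) using 1
    ext y
    simp only [mem_image, mem_univ, true_and, mem_range, Fin.exists_iff, exists_prop]
  · rw [hwp j (by omega), ← hpu j, zero_add]
  · rw [← hpv j, ← hwp' _ (by omega)]
    congr 1
    omega
end

section
/- Let H be a graph on n vertices with minimum degree δ(H) ≥ x for some integer x ≥ 1, and let A ⊆ V(H) satisfy |A| > n/2 + 9x/2. Then H contains x−1 pairwise vertex-disjoint cherries (paths with three vertices and two edges) whose two leaves each lie in A. -/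
open Finset

namespace CherryPacking

variable {V : Type*} [DecidableEq V]

/-- The vertex set of a triple. -/
def verts (t : V × V × V) : Finset V := {t.1, t.2.1, t.2.2}

/-- `t` lists the vertices of a cherry, centre in the middle, with both leaves in `A`. -/
def IsCherry (H : SimpleGraph V) (A : Finset V) (t : V × V × V) : Prop :=
  H.Adj t.1 t.2.1 ∧ H.Adj t.2.1 t.2.2 ∧ t.1 ≠ t.2.2 ∧ t.1 ∈ A ∧ t.2.2 ∈ A

/-- A finite family of pairwise vertex-disjoint cherries with leaves in `A`. -/
def IsPacking (H : SimpleGraph V) (A : Finset V) (S : Finset (V × V × V)) : Prop :=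
  (∀ t ∈ S, IsCherry H A t) ∧ (S : Set (V × V × V)).PairwiseDisjoint verts

variable {H : SimpleGraph V} {A : Finset V} {S : Finset (V × V × V)}

lemma verts_nonempty (t : V × V × V) : (verts t).Nonempty := ⟨t.1, by simp [verts]⟩

lemma card_verts_le (t : V × V × V) : #(verts t) ≤ 3 := card_le_three

lemma IsPacking.subset {T : Finset (V × V × V)} (hS : IsPacking H A S) (h : T ⊆ S) :
    IsPacking H A T :=
  ⟨fun t ht => hS.1 t (h ht), hS.2.subset (by exact_mod_cast h)⟩

lemma notMem_of_disjoint_verts {t : V × V × V}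
    (hd : ∀ s ∈ S, Disjoint (verts t) (verts s)) : t ∉ S := fun h =>
  (verts_nonempty t).ne_empty (disjoint_self.mp (hd t h))

lemma IsPacking.insert_cherry {t : V × V × V} (hS : IsPacking H A S) (ht : IsCherry H A t)
    (hd : ∀ s ∈ S, Disjoint (verts t) (verts s)) : IsPacking H A (insert t S) := by
  refine ⟨?_, ?_⟩
  · intro s hs
    rcases mem_insert.mp hs with rfl | hs
    exacts [ht, hS.1 s hs]
  · rw [coe_insert]
    exact hS.2.insert fun s hs _ => hd s hs

variable [Fintype V] [DecidableRel H.Adj]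

/-- In a packing that cannot be enlarged, a vertex outside it has at most one neighbour among
the unused vertices of `A`. -/
lemma IsPacking.card_neighbor_le_one (hS : IsPacking H A S)
    (hmax : ∀ T, IsPacking H A T → #T ≠ #S + 1) {v : V} (hv : v ∉ S.biUnion verts) :
    #(H.neighborFinset v ∩ (A \ S.biUnion verts)) ≤ 1 := by
  by_contra! h
  obtain ⟨a, ha, b, hb, hab⟩ := one_lt_card.mp h
  simp only [mem_inter, SimpleGraph.mem_neighborFinset, mem_sdiff, mem_biUnion, not_exists,
    not_and] at ha hb hv
  have hd : ∀ s ∈ S, Disjoint (verts (a, v, b)) (verts s) := by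
    intro s hs
    simp only [verts, disjoint_insert_left, disjoint_singleton_left]
    exact ⟨ha.2.2 s hs, hv s hs, hb.2.2 s hs⟩
  exact hmax _ (hS.insert_cherry ⟨ha.1.symm, hb.1, hab, ha.2.1, hb.2.1⟩ hd)
    (card_insert_of_notMem (notMem_of_disjoint_verts hd))

/-- In a packing that cannot be enlarged, two vertices of the same cherry cannot both have four
neighbours among the unused vertices of `A`: otherwise that cherry could be traded for two. -/
lemma IsPacking.card_neighbor_lt_four_or (hS : IsPacking H A S)
    (hmax : ∀ T, IsPacking H A T → #T ≠ #S + 1) {t : V × V × V} (ht : t ∈ S) {p q : V}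
    (hp : p ∈ verts t) (hq : q ∈ verts t) (hpq : p ≠ q) :
    #(H.neighborFinset p ∩ (A \ S.biUnion verts)) < 4 ∨
      #(H.neighborFinset q ∩ (A \ S.biUnion verts)) < 4 := by
  by_contra! h
  obtain ⟨a, ha, b, hb, hab⟩ := one_lt_card.mp (lt_of_lt_of_le (by norm_num) h.1)
  have h2 : 1 < #((H.neighborFinset q ∩ (A \ S.biUnion verts)) \ {a, b}) := by
    have h1 := le_card_sdiff {a, b} (H.neighborFinset q ∩ (A \ S.biUnion verts))
    have h3 : #{a, b} ≤ 2 := card_le_two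
    have h4 := h.2
    omega
  obtain ⟨c, hc, d, hd, hcd⟩ := one_lt_card.mp h2
  simp only [mem_inter, SimpleGraph.mem_neighborFinset, mem_sdiff, mem_biUnion, not_exists,
    not_and, mem_insert, mem_singleton, not_or] at ha hb hc hd
  have hother : ∀ s ∈ S.erase t, ∀ v ∈ verts t, v ∉ verts s := by
    intro s hs v hv
    exact disjoint_left.mp (hS.2 ht (mem_of_mem_erase hs) (ne_of_mem_erase hs).symm) hv
  have hd₁ : ∀ s ∈ S.erase t, Disjoint (verts (a, p, b)) (verts s) := by
    intro s hs
    simp only [verts, disjoint_insert_left, disjoint_singleton_left]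
    exact ⟨ha.2.2 s (mem_of_mem_erase hs), hother s hs p hp, hb.2.2 s (mem_of_mem_erase hs)⟩
  have hd₂ : ∀ s ∈ insert (a, p, b) (S.erase t), Disjoint (verts (c, q, d)) (verts s) := by
    intro s hs
    rcases mem_insert.mp hs with rfl | hs
    · have hne : ∀ {y v : V}, (∀ s ∈ S, y ∉ verts s) → v ∈ verts t → y ≠ v := by
        rintro y v hy hv rfl
        exact hy t ht hv
      have hcp := hne hc.1.2.2 hp
      have hdp := hne hd.1.2.2 hp
      have haq := hne ha.2.2 hq
      have hbq := hne hb.2.2 hq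
      simp only [verts, disjoint_insert_left, disjoint_singleton_left, mem_insert,
        mem_singleton, not_or]
      exact ⟨⟨hc.2.1, hcp, hc.2.2⟩, ⟨haq.symm, hpq.symm, hbq.symm⟩, hd.2.1, hdp, hd.2.2⟩
    · simp only [verts, disjoint_insert_left, disjoint_singleton_left]
      exact ⟨hc.1.2.2 s (mem_of_mem_erase hs), hother s hs q hq,
        hd.1.2.2 s (mem_of_mem_erase hs)⟩
  refine hmax _ (((hS.subset (erase_subset t S)).insert_cherry
    (show IsCherry H A (a, p, b) from ⟨ha.1.symm, hb.1, hab, ha.2.1, hb.2.1⟩) hd₁).insert_cherry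
    (show IsCherry H A (c, q, d) from ⟨hc.1.1.symm, hd.1.1, hcd, hc.1.2.1, hd.1.2.1⟩) hd₂) ?_
  rw [card_insert_of_notMem (notMem_of_disjoint_verts hd₂),
    card_insert_of_notMem (notMem_of_disjoint_verts hd₁), card_erase_add_one ht]

lemma IsPacking.sum_verts_le (hS : IsPacking H A S)
    (hmax : ∀ T, IsPacking H A T → #T ≠ #S + 1) {t : V × V × V} (ht : t ∈ S) :
    ∑ v ∈ verts t, #(H.neighborFinset v ∩ (A \ S.biUnion verts)) ≤
      #(A \ S.biUnion verts) + 6 := by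
  obtain ⟨h₁, h₂, h₃, -, -⟩ := hS.1 t ht
  have key := fun p q => hS.card_neighbor_lt_four_or hmax ht (p := p) (q := q)
  have h12 := key t.1 t.2.1 (by simp [verts]) (by simp [verts]) h₁.ne
  have h23 := key t.2.1 t.2.2 (by simp [verts]) (by simp [verts]) h₂.ne
  have h13 := key t.1 t.2.2 (by simp [verts]) (by simp [verts]) h₃
  have hle : ∀ v, #(H.neighborFinset v ∩ (A \ S.biUnion verts)) ≤ #(A \ S.biUnion verts) :=
    fun v => card_le_card inter_subset_right
  have l1 := hle t.1
  have l2 := hle t.2.1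
  have l3 := hle t.2.2
  rw [verts, sum_insert (by simp [h₁.ne, h₃]), sum_insert (by simp [h₂.ne]), sum_singleton]
  omega

lemma sum_degree_eq_sum_card_neighbor (B : Finset V) :
    ∑ a ∈ B, H.degree a = ∑ v, #(H.neighborFinset v ∩ B) := by
  have h := sum_card_bipartiteAbove_eq_sum_card_bipartiteBelow (s := B) (t := univ) H.Adj
  convert h using 3 with a _ v _
  · rw [← SimpleGraph.card_neighborFinset_eq_degree]
    congr 1
    ext v
    simp [bipartiteAbove]
  · ext a
    simp [bipartiteBelow, H.adj_comm, and_comm]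

lemma IsPacking.exists_card_eq_succ {x : ℕ} (hdeg : ∀ v, x ≤ H.degree v)
    (hA : Fintype.card V + 9 * x < 2 * #A) (hS : IsPacking H A S) (hcard : #S + 2 ≤ x) :
    ∃ T, IsPacking H A T ∧ #T = #S + 1 := by
  by_contra! hmax
  set U := S.biUnion verts with hU
  have hUcard : #U ≤ #S * 3 := card_biUnion_le_card_mul _ _ _ fun t _ => card_verts_le t
  have hin : ∑ v ∈ U, #(H.neighborFinset v ∩ (A \ U)) ≤ #S * (#(A \ U) + 6) := by
    rw [hU, sum_biUnion hS.2, ← smul_eq_mul]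
    exact sum_le_card_nsmul _ _ _ fun t ht => hS.sum_verts_le hmax ht
  have hout : ∑ v ∈ Uᶜ, #(H.neighborFinset v ∩ (A \ U)) ≤ #Uᶜ := by
    simpa using sum_le_card_nsmul Uᶜ _ 1 fun v hv =>
      hS.card_neighbor_le_one hmax (mem_compl.mp hv)
  have hlow : #(A \ U) * x ≤ ∑ a ∈ A \ U, H.degree a := by
    simpa using card_nsmul_le_sum (A \ U) (fun a => H.degree a) x fun a _ => hdeg a
  rw [sum_degree_eq_sum_card_neighbor, ← sum_add_sum_compl U] at hlow
  have hsd := le_card_sdiff U A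
  have hcompl := card_add_card_compl U
  obtain ⟨m, rfl⟩ := Nat.exists_eq_add_of_le hcard
  nlinarith [Nat.zero_le (#(A \ U) * m), show #A ≤ #(A \ U) + #U by omega]

lemma exists_packing_card_eq {x : ℕ} (hdeg : ∀ v, x ≤ H.degree v)
    (hA : Fintype.card V + 9 * x < 2 * #A) :
    ∀ k, k + 1 ≤ x → ∃ S, IsPacking H A S ∧ #S = k
  | 0, _ => ⟨∅, by simp [IsPacking], rfl⟩
  | k + 1, hk => by
    obtain ⟨S, hS, rfl⟩ := exists_packing_card_eq hdeg hA k (by omega)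
    exact hS.exists_card_eq_succ hdeg hA hk

end CherryPacking

/-- If `H` is a graph on `n` vertices with minimum degree at least `x ≥ 1` and
`A ⊆ V(H)` satisfies `|A| > n/2 + 9x/2`, then `H` contains `x - 1` pairwise
vertex-disjoint cherries (paths with two edges) whose leaves lie in `A`. -/
theorem disjoint_cherries_with_leaves_in_A
    (n x : ℕ) (hx : 1 ≤ x) (H : SimpleGraph (Fin n)) [DecidableRel H.Adj]
    (hdeg : ∀ v : Fin n, x ≤ H.degree v)
    (A : Finset (Fin n)) (hA : (n : ℝ) / 2 + 9 * (x : ℝ) / 2 < (A.card : ℝ)) :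
    ∃ c : Fin (x - 1) → Fin n × Fin n × Fin n,
      (∀ i : Fin (x - 1),
        H.Adj (c i).1 (c i).2.1 ∧ H.Adj (c i).2.1 (c i).2.2 ∧
        (c i).1 ≠ (c i).2.2 ∧ (c i).1 ∈ A ∧ (c i).2.2 ∈ A) ∧
      (∀ i j : Fin (x - 1), i ≠ j →
        Disjoint ({(c i).1, (c i).2.1, (c i).2.2} : Finset (Fin n))
          ({(c j).1, (c j).2.1, (c j).2.2} : Finset (Fin n))) := by
  have hA' : Fintype.card (Fin n) + 9 * x < 2 * #A := by
    have h : ((n + 9 * x : ℕ) : ℝ) < ((2 * #A : ℕ) : ℝ) := by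
      push_cast
      linarith
    simpa using Nat.cast_lt.mp h
  obtain ⟨S, ⟨hcherry, hdisj⟩, hcard⟩ :=
    CherryPacking.exists_packing_card_eq hdeg hA' (x - 1) (by omega)
  let e := (S.equivFinOfCardEq hcard).symm
  refine ⟨fun i => e i, fun i => hcherry _ (e i).2, fun i j hij => ?_⟩
  exact hdisj (e i).2 (e j).2 fun h => hij (e.injective (Subtype.ext h))
end

section
/- Let k ≥ 2. There exists δ₀ > 0 (depending on k) such that for every δ ∈ (0, δ₀] there exists ε₀ > 0 such that for every ε ∈ (0, ε₀] there exists n₀ such that the following holds for every n ≥ n₀. If F is an n-vertex k-graph with at least (1−ε)·C(n,k) edges, then there exists a subgraph F' of F with no isolated vertices such that every supported set of F' of size at most k−1 has vertex co-degree at least (1−δ)n in F' (in particular δ*(F') ≥ (1−δ)n); consequently F' has at least (1−δ)n vertices and at least (1−kδ)·C(n,k) edges. -/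
open Finset

section Cleaning

variable {V : Type*} [Fintype V] [DecidableEq V]

/-- Double counting of the pairs `(S, v)` with `S ∈ A`, `v ∉ S` and `insert v S ∈ B`. -/
lemma card_mul_le_of_forall_le_card_insert (A B : Finset (Finset V)) (m : ℝ) (d : ℕ)
    (hA : ∀ S ∈ A, m ≤ (#{v | v ∉ S ∧ insert v S ∈ B} : ℝ))
    (hB : ∀ T ∈ B, #T ≤ d) : (#A : ℝ) * m ≤ d * #B := by
  have hinj : #(A.sigma fun S => ({v | v ∉ S ∧ insert v S ∈ B} : Finset V)) ≤
      #(B.sigma fun T => T) := by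
    refine Finset.card_le_card_of_injOn (fun p => ⟨insert p.2 p.1, p.2⟩) ?_ ?_
    · rintro ⟨S, v⟩ h
      simp only [coe_sigma, Set.mem_sigma_iff, mem_coe, mem_filter, mem_univ, true_and] at h ⊢
      exact ⟨h.2.2, mem_insert_self _ _⟩
    · rintro ⟨S, v⟩ h ⟨S', v'⟩ h' heq
      simp only [coe_sigma, Set.mem_sigma_iff, mem_coe, mem_filter, mem_univ, true_and] at h h'
      simp only [Sigma.mk.injEq, heq_eq_eq] at heq
      obtain ⟨h1, rfl⟩ := heq
      have : S = S' := by
        rw [← erase_insert h.2.1, ← erase_insert h'.2.1, h1]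
      rw [this]
  rw [card_sigma, card_sigma] at hinj
  have hle : ∑ T ∈ B, #T ≤ d * #B := by
    have := sum_le_card_nsmul B (fun T => #T) d hB
    simpa [mul_comm] using this
  calc (#A : ℝ) * m = ∑ _S ∈ A, m := by simp
    _ ≤ ∑ S ∈ A, (#{v | v ∉ S ∧ insert v S ∈ B} : ℝ) := sum_le_sum hA
    _ ≤ d * #B := by exact_mod_cast hinj.trans hle

open Classical in
/-- The bad `(k - j)`-sets relative to a `k`-graph `E` and a threshold `b`: a `k`-set is bad if it
is not an edge, and a smaller set is bad if it has at least `b` bad one-point extensions. -/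
noncomputable def badSets (E : Finset (Finset V)) (k : ℕ) (b : ℝ) : ℕ → Finset (Finset V)
  | 0 => powersetCard k univ \ E
  | j + 1 => {S ∈ powersetCard (k - (j + 1)) univ |
      b ≤ (#{v | v ∉ S ∧ insert v S ∈ badSets E k b j} : ℝ)}

lemma card_of_mem_badSets {E : Finset (Finset V)} {k : ℕ} {b : ℝ} {j : ℕ} {S : Finset V}
    (h : S ∈ badSets E k b j) : #S = k - j := by
  cases j with
  | zero => simpa using (mem_powersetCard.1 (mem_sdiff.1 h).1).2
  | succ j => exact (mem_powersetCard.1 (mem_filter.1 h).1).2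

lemma card_badSets_mul_pow_le (E : Finset (Finset V)) (k : ℕ) {b : ℝ} (hb : 0 ≤ b) (j : ℕ) :
    (#(badSets E k b j) : ℝ) * b ^ j ≤ (k : ℝ) ^ j * #(powersetCard k univ \ E) := by
  induction j with
  | zero => simp [badSets]
  | succ j ih =>
    have hstep : (#(badSets E k b (j + 1)) : ℝ) * b ≤ k * #(badSets E k b j) := by
      refine card_mul_le_of_forall_le_card_insert _ _ _ _ (fun S hS => ?_) (fun T hT => ?_)
      · convert (mem_filter.1 hS).2
      · rw [card_of_mem_badSets hT]; omega
    calc (#(badSets E k b (j + 1)) : ℝ) * b ^ (j + 1)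
        = (#(badSets E k b (j + 1)) * b) * b ^ j := by ring
      _ ≤ (k * #(badSets E k b j)) * b ^ j := by gcongr
      _ = k * (#(badSets E k b j) * b ^ j) := by ring
      _ ≤ k * ((k : ℝ) ^ j * #(powersetCard k univ \ E)) := by gcongr
      _ = _ := by ring

/-- A set is good if none of its subsets is bad. -/
def IsGoodSet (E : Finset (Finset V)) (k : ℕ) (b : ℝ) (S : Finset V) : Prop :=
  ∀ T ⊆ S, ∀ j ≤ k, T ∉ badSets E k b j

lemma IsGoodSet.mono {E : Finset (Finset V)} {k : ℕ} {b : ℝ} {S T : Finset V}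
    (h : IsGoodSet E k b S) (hT : T ⊆ S) : IsGoodSet E k b T :=
  fun U hU => h U (hU.trans hT)

lemma IsGoodSet.mem {E : Finset (Finset V)} {k : ℕ} {b : ℝ} {S : Finset V}
    (h : IsGoodSet E k b S) (hS : #S = k) : S ∈ E := by
  by_contra hE
  exact h S Subset.rfl 0 k.zero_le
    (mem_sdiff.2 ⟨mem_powersetCard.2 ⟨subset_univ _, hS⟩, hE⟩)

open Classical in
lemma IsGoodSet.card_insert_lt {E : Finset (Finset V)} {k : ℕ} {b : ℝ} {S : Finset V}
    (h : IsGoodSet E k b S) (hS : #S < k) :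
    (#{v | v ∉ S ∧ insert v S ∈ badSets E k b (k - (#S + 1))} : ℝ) < b := by
  by_contra! hle
  refine h S Subset.rfl (k - (#S + 1) + 1) (by omega)
    (mem_filter.2 ⟨mem_powersetCard.2 ⟨subset_univ _, by omega⟩, ?_⟩)
  convert hle

open Classical in
lemma IsGoodSet.le_card_insert {E : Finset (Finset V)} {k : ℕ} {b : ℝ} {S : Finset V}
    (h : IsGoodSet E k b S) (hS : #S < k) (hb : 0 ≤ b) :
    (Fintype.card V : ℝ) - (k + 2 ^ k * b) ≤
      (#{v | v ∉ S ∧ IsGoodSet E k b (insert v S)} : ℝ) := by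
  set G : Finset V := {v | v ∉ S ∧ IsGoodSet E k b (insert v S)} with hG
  set X : Finset V → Finset V :=
    fun T => {v | v ∉ T ∧ insert v T ∈ badSets E k b (k - (#T + 1))} with hX
  have hcover : (univ : Finset V) ⊆ G ∪ (S ∪ S.powerset.biUnion X) := by
    intro v _
    by_cases hvS : v ∈ S
    · simp [hvS]
    by_cases hgood : IsGoodSet E k b (insert v S)
    · simp [hG, hvS, hgood]
    have hbad : ∃ T ⊆ insert v S, ∃ j ≤ k, T ∈ badSets E k b j := by
      simpa [IsGoodSet] using hgood
    obtain ⟨T, hT, j, hjk, hj⟩ := hbad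
    have hvT : v ∈ T := by
      by_contra hvT
      exact h T ((subset_insert_iff_of_notMem hvT).1 hT) j hjk hj
    refine mem_union_right _ (mem_union_right _ (mem_biUnion.2 ⟨T.erase v, ?_, ?_⟩))
    · exact mem_powerset.2 (subset_insert_iff.1 hT)
    · have hcard := card_of_mem_badSets hj
      have hpos : 0 < #T := card_pos.2 ⟨v, hvT⟩
      have hidx : k - (#(T.erase v) + 1) = j := by
        rw [card_erase_of_mem hvT]; omega
      simp only [hX, mem_filter, mem_univ, true_and, hidx, insert_erase hvT, hj, and_true]
      exact notMem_erase v T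
  have hXle : ∀ T ∈ S.powerset, (#(X T) : ℝ) ≤ b := fun T hT =>
    have hTS := mem_powerset.1 hT
    ((h.mono hTS).card_insert_lt ((card_le_card hTS).trans_lt hS)).le
  have hU : (#(S.powerset.biUnion X) : ℝ) ≤ 2 ^ k * b := by
    calc (#(S.powerset.biUnion X) : ℝ) ≤ ∑ T ∈ S.powerset, (#(X T) : ℝ) := by
          exact_mod_cast card_biUnion_le
      _ ≤ ∑ _T ∈ S.powerset, b := sum_le_sum hXle
      _ = 2 ^ #S * b := by simp
      _ ≤ 2 ^ k * b := by
          have : (2 : ℝ) ^ #S ≤ 2 ^ k := pow_le_pow_right₀ (by norm_num) hS.le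
          gcongr
  have hc : Fintype.card V ≤ #G + (#S + #(S.powerset.biUnion X)) :=
    (card_le_card hcover).trans
      ((card_union_le _ _).trans (Nat.add_le_add_left (card_union_le _ _) _))
  have hc' : (Fintype.card V : ℝ) ≤ #G + (#S + #(S.powerset.biUnion X)) := by exact_mod_cast hc
  have hSk : (#S : ℝ) ≤ k := by exact_mod_cast hS.le
  linarith

/-- If every `P`-set of size less than `k` has a one-point extension in `P`, every `P`-set of size
at most `k` extends to a `P`-set of size `k`. -/
lemma exists_superset_card_eq_of_forall_insert {V : Type*} [DecidableEq V] {P : Finset V → Prop} {k : ℕ}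
    (hP : ∀ S, P S → #S < k → ∃ v ∉ S, P (insert v S)) {S : Finset V} (hS : P S) (hk : #S ≤ k) :
    ∃ e, S ⊆ e ∧ P e ∧ #e = k := by
  induction hd : k - #S generalizing S with
  | zero => exact ⟨S, Subset.rfl, hS, by omega⟩
  | succ d ih =>
    obtain ⟨v, hv, hPv⟩ := hP S hS (by omega)
    have hcard := card_insert_of_notMem hv
    obtain ⟨e, he, h⟩ := ih hPv (by omega) (by omega)
    exact ⟨e, (subset_insert v S).trans he, h⟩

open Classical in
lemma pow_le_factorial_mul_card {P : Finset V → Prop} {k : ℕ} {m : ℝ} (hm : 0 ≤ m) (h0 : P ∅)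
    (hP : ∀ S, P S → #S < k → m ≤ (#{v | v ∉ S ∧ P (insert v S)} : ℝ)) {i : ℕ} (hi : i ≤ k) :
    m ^ i ≤ i.factorial * (#{S : Finset V | P S ∧ #S = i} : ℝ) := by
  induction i with
  | zero =>
    have : 1 ≤ #{S : Finset V | P S ∧ #S = 0} := card_pos.2 ⟨∅, by simp [h0]⟩
    simpa only [pow_zero, Nat.factorial_zero, Nat.cast_one, one_mul, Nat.one_le_cast] using this
  | succ i ih =>
    have hstep : (#{S : Finset V | P S ∧ #S = i} : ℝ) * m ≤
        (i + 1 : ℕ) * (#{S : Finset V | P S ∧ #S = i + 1} : ℝ) := by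
      refine card_mul_le_of_forall_le_card_insert _ _ _ _ (fun S hS => ?_) (fun T hT => ?_)
      · obtain ⟨hPS, hcard⟩ := (mem_filter.1 hS).2
        refine (hP S hPS (by omega)).trans ?_
        refine Nat.cast_le.2 (card_le_card (monotone_filter_right _ fun v _ hv => ?_))
        simp [hv.1, hv.2, hcard]
      · exact (mem_filter.1 hT).2.2.le
    calc m ^ (i + 1) = m ^ i * m := pow_succ _ _
      _ ≤ (i.factorial * (#{S : Finset V | P S ∧ #S = i} : ℝ)) * m := by
          gcongr; exact ih (by omega)
      _ = i.factorial * ((#{S : Finset V | P S ∧ #S = i} : ℝ) * m) := by ring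
      _ ≤ i.factorial * ((i + 1 : ℕ) * (#{S : Finset V | P S ∧ #S = i + 1} : ℝ)) := by gcongr
      _ = _ := by rw [Nat.factorial_succ]; push_cast; ring

lemma isGoodSet_empty {E : Finset (Finset V)} {k : ℕ} {b : ℝ} (hb : 0 ≤ b)
    (hE : (k : ℝ) ^ k * #(powersetCard k univ \ E) < b ^ k) : IsGoodSet E k b ∅ := by
  intro T hT j hjk hmem
  obtain rfl := subset_empty.1 hT
  have hcard := card_of_mem_badSets hmem
  rw [card_empty] at hcard
  obtain rfl : j = k := by omega
  have h1 : (1 : ℝ) ≤ #(badSets E j b j) := by exact_mod_cast card_pos.2 ⟨∅, hmem⟩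
  have h2 := card_badSets_mul_pow_le E j hb j
  have h3 : b ^ j ≤ #(badSets E j b j) * b ^ j := le_mul_of_one_le_left (by positivity) h1
  linarith

end Cleaning

/-- Cleaning lemma: an almost complete `k`-graph contains a subgraph (given by
its edge set `E'`; its vertex set is the set of covered vertices, so it has no
isolated vertices) in which every supported set of size at most `k-1` has
vertex co-degree at least `(1-δ)n`; in particular `δ*(F') ≥ (1-δ)n`, `F'` has
at least `(1-δ)n` vertices and at least `(1-kδ)·C(n,k)` edges. -/
theorem cleaning_lemma (k : ℕ) (hk : 2 ≤ k) :
    ∃ δ₀ : ℝ, 0 < δ₀ ∧ ∀ δ : ℝ, 0 < δ → δ ≤ δ₀ →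
    ∃ ε₀ : ℝ, 0 < ε₀ ∧ ∀ ε : ℝ, 0 < ε → ε ≤ ε₀ →
    ∃ n₀ : ℕ, ∀ n : ℕ, n₀ ≤ n →
    ∀ E : Finset (Finset (Fin n)),
      (∀ e ∈ E, e.card = k) →
      (1 - ε) * (Nat.choose n k : ℝ) ≤ (E.card : ℝ) →
      ∃ E' ⊆ E,
        (∀ S : Finset (Fin n), S.card ≤ k - 1 → (∃ e ∈ E', S ⊆ e) →
          (1 - δ) * (n : ℝ) ≤
            ((Finset.univ.filter fun v => v ∉ S ∧ ∃ e ∈ E', insert v S ⊆ e).card : ℝ)) ∧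
        (∀ S : Finset (Fin n), S.card = k - 1 → (∃ e ∈ E', S ⊆ e) →
          (1 - δ) * (n : ℝ) ≤ ((E'.filter fun e => S ⊆ e).card : ℝ)) ∧
        (1 - δ) * (n : ℝ) ≤ ((E'.biUnion id).card : ℝ) ∧
        (1 - (k : ℝ) * δ) * (Nat.choose n k : ℝ) ≤ (E'.card : ℝ) := by
  classical
  have hk0 : (0 : ℝ) < k := by exact_mod_cast (by omega : 0 < k)
  refine ⟨1 / k, by positivity, fun δ hδ hδk => ?_⟩
  have hkδ : k * δ ≤ 1 := by rwa [le_div_iff₀' hk0] at hδk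
  have hk2 : (2 : ℝ) ≤ k := by exact_mod_cast hk
  have hδ1 : δ < 1 := by nlinarith
  set β : ℝ := δ / (2 * 2 ^ k) with hβ
  have hβ0 : 0 < β := by positivity
  refine ⟨β ^ k / (2 * k ^ k), by positivity, fun ε hε hεβ => ?_⟩
  obtain ⟨n₀, hn₀⟩ := exists_nat_ge (2 * k / δ)
  refine ⟨n₀, fun n hn E hEk hE => ?_⟩
  have hnδ : 2 * k ≤ n * δ := by
    rw [← div_le_iff₀ hδ]
    exact hn₀.trans (by exact_mod_cast hn)
  have hnpos : (0 : ℝ) < n := by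
    by_contra! h
    nlinarith
  have hmissing : (#(powersetCard k univ \ E) : ℝ) ≤ ε * n ^ k := by
    have hsub : E ⊆ powersetCard k univ := fun e he =>
      mem_powersetCard.2 ⟨subset_univ _, hEk e he⟩
    have hchoose : (n.choose k : ℝ) ≤ n ^ k := by exact_mod_cast Nat.choose_le_pow n k
    rw [cast_card_sdiff hsub, card_powersetCard, card_univ, Fintype.card_fin]
    nlinarith
  have hempty : IsGoodSet E k (β * n) ∅ := by
    refine isGoodSet_empty (by positivity) ?_
    have hkε : k ^ k * ε ≤ β ^ k / 2 := by
      rw [le_div_iff₀ (by positivity)] at hεβ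
      linarith
    calc (k : ℝ) ^ k * #(powersetCard k univ \ E) ≤ k ^ k * (ε * n ^ k) := by gcongr
      _ = (k ^ k * ε) * n ^ k := by ring
      _ ≤ β ^ k / 2 * n ^ k := by gcongr
      _ < β ^ k * n ^ k := by
          gcongr
          exact half_lt_self (by positivity)
      _ = (β * n) ^ k := (mul_pow _ _ _).symm
  have hext : ∀ S : Finset (Fin n), IsGoodSet E k (β * n) S → #S < k →
      (1 - δ) * (n : ℝ) ≤ (#{v | v ∉ S ∧ IsGoodSet E k (β * n) (insert v S)} : ℝ) := by
    intro S hS hSk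
    refine le_trans ?_ (hS.le_card_insert hSk (by positivity))
    have hβn : 2 ^ k * (β * n) = n * δ / 2 := by
      rw [hβ]; field_simp
    rw [Fintype.card_fin, hβn]
    linarith
  have hm : 0 < (1 - δ) * (n : ℝ) := mul_pos (by linarith) hnpos
  have hex : ∀ S : Finset (Fin n), IsGoodSet E k (β * n) S → #S < k →
      ∃ v ∉ S, IsGoodSet E k (β * n) (insert v S) := by
    intro S hS hSk
    have hpos := hm.trans_le (hext S hS hSk)
    obtain ⟨v, hv⟩ := card_pos.1 (Nat.cast_pos.1 hpos)
    exact ⟨v, (mem_filter.1 hv).2⟩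
  set E' : Finset (Finset (Fin n)) := {S | IsGoodSet E k (β * n) S ∧ #S = k} with hE'
  have hmem : ∀ e, e ∈ E' ↔ IsGoodSet E k (β * n) e ∧ #e = k := by simp [hE']
  have hsupp : ∀ S, IsGoodSet E k (β * n) S → #S ≤ k → ∃ e ∈ E', S ⊆ e := by
    intro S hS hSk
    obtain ⟨e, he, hgood, hcard⟩ := exists_superset_card_eq_of_forall_insert hex hS hSk
    exact ⟨e, (hmem e).2 ⟨hgood, hcard⟩, he⟩
  refine ⟨E', fun e he => ((hmem e).1 he).1.mem ((hmem e).1 he).2, ?_, ?_, ?_, ?_⟩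
  · rintro S hSk ⟨e, he, hSe⟩
    refine (hext S (((hmem e).1 he).1.mono hSe) (by omega)).trans ?_
    refine Nat.cast_le.2 (card_le_card (monotone_filter_right _ fun v _ hv => ?_))
    obtain ⟨hv, hgood⟩ := hv
    exact ⟨hv, hsupp _ hgood (by rw [card_insert_of_notMem hv]; omega)⟩
  · rintro S hSk ⟨e, he, hSe⟩
    refine (hext S (((hmem e).1 he).1.mono hSe) (by omega)).trans ?_
    refine Nat.cast_le.2 (card_le_card_of_injOn (fun v => insert v S) ?_ ?_)
    · intro v hv
      obtain ⟨hvS, hgood⟩ := (mem_filter.1 hv).2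
      refine mem_coe.2 (mem_filter.2 ⟨(hmem _).2 ⟨hgood, ?_⟩, subset_insert _ _⟩)
      rw [card_insert_of_notMem hvS]; omega
    · intro v hv w _ hvw
      exact (insert_inj (mem_filter.1 hv).2.1).1 hvw
  · refine (hext ∅ hempty (by rw [card_empty]; omega)).trans ?_
    refine Nat.cast_le.2 (card_le_card fun v hv => ?_)
    obtain ⟨hv, hgood⟩ := (mem_filter.1 hv).2
    obtain ⟨e, he, hve⟩ := hsupp _ hgood (by rw [card_insert_of_notMem hv, card_empty]; omega)
    exact mem_biUnion.2 ⟨e, he, hve (mem_insert_self _ _)⟩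
  · have hcount := pow_le_factorial_mul_card hm.le hempty hext le_rfl
    have hbern : 1 - k * δ ≤ (1 - δ) ^ k := by
      have := one_add_mul_le_pow (by linarith : (-2 : ℝ) ≤ -δ) k
      simpa [sub_eq_add_neg] using this
    have hfac : (k.factorial : ℝ) * n.choose k ≤ n ^ k := by
      rw [← Nat.cast_mul, ← Nat.descFactorial_eq_factorial_mul_choose]
      exact_mod_cast Nat.descFactorial_le_pow n k
    have hfac0 : (0 : ℝ) < k.factorial := by exact_mod_cast k.factorial_pos
    refine le_of_mul_le_mul_left ?_ hfac0
    calc (k.factorial : ℝ) * ((1 - k * δ) * n.choose k)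
        = (1 - k * δ) * (k.factorial * n.choose k) := by ring
      _ ≤ (1 - k * δ) * n ^ k := mul_le_mul_of_nonneg_left hfac (by linarith)
      _ ≤ (1 - δ) ^ k * n ^ k := by gcongr
      _ = ((1 - δ) * n) ^ k := (mul_pow _ _ _).symm
      _ ≤ _ := hcount
end
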